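/- arXiv:1608.01395 — 3 statements merged into one kernel-verified Lean document; each statement's English description precedes it below -/
import Mathlib

section
/- Let n > d ≥ 1 be integers and write points of ℝⁿ \ ℝ^d as (x,t) with x ∈ ℝ^d and t ∈ ℝ^{n−d}, t ≠ 0. Let g : ℝ^d × (0,∞) → ℝ be twice continuously differentiable and set u(x,t) = g(x,|t|). Then at every point (x,t) with t ≠ 0 one has div( |t|^{d+1−n} ∇u )(x,t) = |t|^{d+1−n} ( Δ_x g + ∂_r² g )(x,|t|); that is, the operator L = div( dist(·,ℝ^d)^{d+1−n} ∇ ) acts on functions that are radial in the t-variable exactly as the Laplacian acts on functions on ℝ^{d+1}_+ = ℝ^d × (0,∞). -/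
open Set

noncomputable section

/-- The Euclidean norm `|t|` of `t ∈ ℝ^m`. -/
def rr (m : ℕ) (t : Fin m → ℝ) : ℝ := Real.sqrt (∑ j, t j ^ 2)

/-- Partial derivative of `f(x,t)` in the `i`-th `x`-variable. -/
def pdX (d m : ℕ) (f : (Fin d → ℝ) → (Fin m → ℝ) → ℝ) (i : Fin d)
    (x : Fin d → ℝ) (t : Fin m → ℝ) : ℝ :=
  deriv (fun s => f (Function.update x i s) t) (x i)

/-- Partial derivative of `f(x,t)` in the `j`-th `t`-variable. -/
def pdT (d m : ℕ) (f : (Fin d → ℝ) → (Fin m → ℝ) → ℝ) (j : Fin m)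
    (x : Fin d → ℝ) (t : Fin m → ℝ) : ℝ :=
  deriv (fun s => f x (Function.update t j s)) (t j)

lemma rr_pos_aux (m : ℕ) (t : Fin m → ℝ) (ht : t ≠ 0) : 0 < rr m t := by
  unfold rr
  apply Real.sqrt_pos.2
  obtain ⟨j, hj⟩ := Function.ne_iff.1 ht
  have hj' : t j ≠ 0 := hj
  exact Finset.sum_pos' (fun i _ => sq_nonneg _) ⟨j, Finset.mem_univ _, by positivity⟩

lemma rr_sq_aux (m : ℕ) (t : Fin m → ℝ) : ∑ j, t j ^ 2 = rr m t ^ 2 := by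
  unfold rr
  rw [Real.sq_sqrt (Finset.sum_nonneg fun i _ => sq_nonneg _)]

lemma rr_deriv_aux (m : ℕ) (t : Fin m → ℝ) (ht : t ≠ 0) (j : Fin m) :
    HasDerivAt (fun s => rr m (Function.update t j s)) (t j / rr m t) (t j) := by
  have h1 : HasDerivAt (fun s => ∑ i, (Function.update t j s) i ^ 2) (2 * t j) (t j) := by
    have e : (fun s => ∑ i, (Function.update t j s) i ^ 2)
        = fun s => s ^ 2 + ∑ i ∈ Finset.univ.erase j, t i ^ 2 := by
      funext s
      rw [← Finset.add_sum_erase _ _ (Finset.mem_univ j)]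
      congr 1
      · simp
      · apply Finset.sum_congr rfl
        intro i hi
        rw [Function.update_of_ne (Finset.ne_of_mem_erase hi)]
    rw [e]
    simpa using (hasDerivAt_pow 2 (t j)).add_const (∑ i ∈ Finset.univ.erase j, t i ^ 2)
  have hp := rr_pos_aux m t ht
  have h2 := h1.sqrt (by
    simp only [Function.update_eq_self]
    rw [rr_sq_aux]; positivity)
  simp only [Function.update_eq_self] at h2
  have e2 : 2 * t j / (2 * Real.sqrt (∑ i, t i ^ 2)) = t j / rr m t := by
    unfold rr
    rw [mul_div_mul_left _ _ two_ne_zero]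
  rw [e2] at h2
  exact h2

lemma pdT_radial_aux (d m : ℕ) (g : (Fin d → ℝ) → ℝ → ℝ) (x : Fin d → ℝ)
    (h1 : ∀ r, 0 < r → DifferentiableAt ℝ (g x) r)
    (t : Fin m → ℝ) (ht : t ≠ 0) (j : Fin m) :
    pdT d m (fun a b => g a (rr m b)) j x t = deriv (g x) (rr m t) * (t j / rr m t) := by
  unfold pdT
  have hd := rr_deriv_aux m t ht j
  have hg : HasDerivAt (g x) (deriv (g x) (rr m t)) (rr m (Function.update t j (t j))) := by
    rw [Function.update_eq_self]
    exact (h1 _ (rr_pos_aux m t ht)).hasDerivAt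
  exact (hg.comp (t j) hd).deriv

lemma pdT_two_aux (d m : ℕ) (k : ℝ) (g : (Fin d → ℝ) → ℝ → ℝ) (x : Fin d → ℝ)
    (h1 : ∀ r, 0 < r → DifferentiableAt ℝ (g x) r)
    (h2 : ∀ r, 0 < r → DifferentiableAt ℝ (deriv (g x)) r)
    (t : Fin m → ℝ) (ht : t ≠ 0) (j : Fin m) :
    pdT d m (fun x' t' => rr m t' ^ k * pdT d m (fun a b => g a (rr m b)) j x' t') j x t
      = rr m t ^ k * (deriv (deriv (g x)) (rr m t) * (t j ^ 2 / rr m t ^ 2)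
          + deriv (g x) (rr m t) * (1 / rr m t)
          + (k - 1) * deriv (g x) (rr m t) * (t j ^ 2 / rr m t ^ 3)) := by
  have hp := rr_pos_aux m t ht
  have hd := rr_deriv_aux m t ht j
  have hu : Function.update t j (t j) = t := Function.update_eq_self j t
  have hev : ∀ᶠ s in nhds (t j), Function.update t j s ≠ 0 := by
    have hc : Continuous (fun s => Function.update t j s) := by fun_prop
    exact hc.continuousAt.eventually_ne (by rw [hu]; exact ht)
  have hE : (fun s => rr m (Function.update t j s) ^ k *
        pdT d m (fun a b => g a (rr m b)) j x (Function.update t j s)) =ᶠ[nhds (t j)]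
      (fun s => rr m (Function.update t j s) ^ k *
        (deriv (g x) (rr m (Function.update t j s)) * (s / rr m (Function.update t j s)))) := by
    filter_upwards [hev] with s hs
    rw [pdT_radial_aux d m g x h1 _ hs j, Function.update_self]
  have hg2 : HasDerivAt (deriv (g x)) (deriv (deriv (g x)) (rr m t))
      (rr m (Function.update t j (t j))) := by
    rw [hu]; exact (h2 _ hp).hasDerivAt
  have hA := hd.rpow_const (p := k) (Or.inl (by rw [hu]; exact hp.ne'))
  have hB := hg2.comp (t j) hd
  have hC := (hasDerivAt_id (t j)).div hd (by rw [hu]; exact hp.ne')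
  have hF := (hA.mul (hB.mul hC))
  have hF' := hF.deriv
  unfold pdT
  unfold pdT at hE
  rw [hE.deriv_eq]
  refine Eq.trans hF' ?_
  simp only [Function.comp, hu, id, Pi.mul_apply, Pi.div_apply]
  rw [Real.rpow_sub_one hp.ne']
  field_simp
  ring

/-- Let `n > d ≥ 1` be integers, `m = n - d`, and let
`g : ℝ^d × (0,∞) → ℝ` be `C²`. Set `u(x,t) = g(x,|t|)`. Then at every `(x,t)` with `t ≠ 0`,
`div(|t|^{d+1-n} ∇u)(x,t) = |t|^{d+1-n} (Δ_x g + ∂_r² g)(x,|t|)`: the operator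
`L = div(dist(·,ℝ^d)^{d+1-n} ∇)` acts on functions radial in `t` exactly as the Laplacian on
`ℝ^{d+1}_+`. -/
theorem statement1 (n d m : ℕ) (hd : 1 ≤ d) (hdn : d < n) (hn : n = d + m)
    (g : (Fin d → ℝ) → ℝ → ℝ)
    (hg : ContDiffOn ℝ 2 (fun q : (Fin d → ℝ) × ℝ => g q.1 q.2) (univ ×ˢ Ioi (0 : ℝ)))
    (x : Fin d → ℝ) (t : Fin m → ℝ) (ht : t ≠ 0) :
    (∑ i : Fin d,
        pdX d m
          (fun x' t' => rr m t' ^ ((d : ℝ) + 1 - (n : ℝ)) *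
            pdX d m (fun a b => g a (rr m b)) i x' t') i x t)
      + (∑ j : Fin m,
        pdT d m
          (fun x' t' => rr m t' ^ ((d : ℝ) + 1 - (n : ℝ)) *
            pdT d m (fun a b => g a (rr m b)) j x' t') j x t)
      = rr m t ^ ((d : ℝ) + 1 - (n : ℝ)) *
        ((∑ i : Fin d, deriv (deriv fun b => g (Function.update x i b) (rr m t)) (x i))
          + deriv (deriv (g x)) (rr m t)) := by
  have hopen : IsOpen ((univ : Set (Fin d → ℝ)) ×ˢ Ioi (0 : ℝ)) := isOpen_univ.prod isOpen_Ioi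
  have hgx : ContDiffOn ℝ 2 (g x) (Ioi (0 : ℝ)) := by
    have hc : ContDiffOn ℝ 2 (fun r : ℝ => (x, r)) (Ioi (0 : ℝ)) := by fun_prop
    exact hg.comp hc (fun r hr => ⟨mem_univ _, hr⟩)
  have h1 : ∀ r, 0 < r → DifferentiableAt ℝ (g x) r := fun r hr =>
    (hgx.differentiableOn (by norm_num)).differentiableAt (Ioi_mem_nhds hr)
  have h2 : ∀ r, 0 < r → DifferentiableAt ℝ (deriv (g x)) r := fun r hr =>
    ((hgx.deriv_of_isOpen (m := 1) isOpen_Ioi (by norm_num)).differentiableOn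
      (by norm_num)).differentiableAt (Ioi_mem_nhds hr)
  have hp := rr_pos_aux m t ht
  rw [Finset.sum_congr rfl (fun j _ => pdT_two_aux d m _ g x h1 h2 t ht j)]
  rw [mul_add, Finset.mul_sum, ← Finset.mul_sum (s := (Finset.univ : Finset (Fin m)))]
  congr 1
  · apply Finset.sum_congr rfl
    intro i _
    simp only [pdX, Function.update_idem, Function.update_self]
    rw [deriv_const_mul_field]
  · congr 1
    rw [Finset.sum_add_distrib, Finset.sum_add_distrib, ← Finset.mul_sum, ← Finset.mul_sum, ← Finset.mul_sum,
      ← Finset.sum_div, ← Finset.sum_div (f := fun j => t j ^ 2), rr_sq_aux]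
    have hnr : (n : ℝ) = d + m := by exact_mod_cast hn
    simp only [Finset.sum_const, Finset.card_univ, Fintype.card_fin, nsmul_eq_mul]
    rw [hnr]
    field_simp
    ring
end
end

section
/- Let u ∈ L¹_loc(ℝⁿ) have a weak gradient G on Ω with ∫_Ω |G|² w dy < ∞. Then for σ-a.e. x ∈ Γ there exists a real number Tu(x) such that lim_{r→0⁺} ⨍_{B(x,r)} |u(y) − Tu(x)| dy = 0, where the average is with respect to Lebesgue measure on ℝⁿ. In particular the trace Tu(x) = lim_{r→0⁺} ⨍_{B(x,r)} u(y) dy exists for σ-a.e. x ∈ Γ. -/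
open MeasureTheory Metric Set Filter ENNReal Topology

noncomputable section

/-- `Γ ⊆ ℝⁿ` is a (nonempty) Ahlfors-regular set of dimension `d` with constant `C₀ ≥ 1`:
`C₀⁻¹ r^d ≤ H^d(Γ ∩ B(x,r)) ≤ C₀ r^d` for all `x ∈ Γ` and `r > 0`. -/
def ADRegular (n : ℕ) (d C₀ : ℝ) (Γ : Set (EuclideanSpace ℝ (Fin n))) : Prop :=
  Γ.Nonempty ∧ ∀ x ∈ Γ, ∀ r : ℝ, 0 < r →
    ENNReal.ofReal (C₀⁻¹ * r ^ d) ≤ μH[d] (Γ ∩ ball x r) ∧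
      μH[d] (Γ ∩ ball x r) ≤ ENNReal.ofReal (C₀ * r ^ d)

/-- The degenerate weight `w(y) = dist(y,Γ)^{d+1-n}`. -/
def wt (n : ℕ) (d : ℝ) (Γ : Set (EuclideanSpace ℝ (Fin n))) (y : EuclideanSpace ℝ (Fin n)) : ℝ :=
  infDist y Γ ^ (d + 1 - (n : ℝ))

/-- The partial derivative `∂ᵢ φ(y)`. -/
def pd (n : ℕ) (φ : EuclideanSpace ℝ (Fin n) → ℝ) (i : Fin n)
    (y : EuclideanSpace ℝ (Fin n)) : ℝ :=
  fderiv ℝ φ y (EuclideanSpace.single i 1)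

/-- `G` is the weak (distributional) gradient of `u` on the set `U`:
`∫_U u ∂ᵢφ = -∫_U Gᵢ φ` for every smooth `φ` compactly supported in `U`. -/
def HasWeakGradOn (n : ℕ) (u : EuclideanSpace ℝ (Fin n) → ℝ)
    (G : EuclideanSpace ℝ (Fin n) → Fin n → ℝ) (U : Set (EuclideanSpace ℝ (Fin n))) : Prop :=
  ∀ φ : EuclideanSpace ℝ (Fin n) → ℝ, ContDiff ℝ (⊤ : ℕ∞) φ → HasCompactSupport φ → tsupport φ ⊆ U →
    ∀ i : Fin n, ∫ y in U, u y * pd n φ i y = - ∫ y in U, G y i * φ y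

/-- `A` is measurable-elliptic with constant `C₁` in the degenerate sense adapted to
codimension `n - d`: `δ(x)^{n-d-1} A(x)ξ·ζ ≤ C₁|ξ||ζ|` and `δ(x)^{n-d-1} A(x)ξ·ξ ≥ C₁⁻¹|ξ|²`. -/
def EllipticA (n : ℕ) (d C₁ : ℝ) (Γ : Set (EuclideanSpace ℝ (Fin n)))
    (A : EuclideanSpace ℝ (Fin n) → Matrix (Fin n) (Fin n) ℝ) : Prop :=
  1 ≤ C₁ ∧ ∀ x, x ∉ Γ → ∀ ξ ζ : EuclideanSpace ℝ (Fin n),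
    infDist x Γ ^ ((n : ℝ) - d - 1) * (∑ i, (A x).mulVec (fun j => ξ j) i * ζ i) ≤
        C₁ * ‖ξ‖ * ‖ζ‖ ∧
      C₁⁻¹ * ‖ξ‖ ^ 2 ≤ infDist x Γ ^ ((n : ℝ) - d - 1) * (∑ i, (A x).mulVec (fun j => ξ j) i * ξ i)

/-- `u` (with weak gradient `G`) is a weak solution of `Lu = div A ∇u = 0` on `U`. -/
def IsWeakSolOn (n : ℕ) (A : EuclideanSpace ℝ (Fin n) → Matrix (Fin n) (Fin n) ℝ)
    (u : EuclideanSpace ℝ (Fin n) → ℝ) (G : EuclideanSpace ℝ (Fin n) → Fin n → ℝ)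
    (U : Set (EuclideanSpace ℝ (Fin n))) : Prop :=
  HasWeakGradOn n u G U ∧
    ∀ φ : EuclideanSpace ℝ (Fin n) → ℝ, ContDiff ℝ (⊤ : ℕ∞) φ → HasCompactSupport φ → tsupport φ ⊆ U →
      ∫ y in U, (∑ i, (A y).mulVec (G y) i * pd n φ i y) = 0

/-- `u` has trace value `T` at the point `x`, in the Lebesgue-density sense:
`⨍_{B(x,ρ)} |u - T| → 0` as `ρ → 0⁺`. -/
def HasTraceAt (n : ℕ) (u : EuclideanSpace ℝ (Fin n) → ℝ) (T : ℝ)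
    (x : EuclideanSpace ℝ (Fin n)) : Prop :=
  Tendsto (fun ρ : ℝ => ⨍ y in ball x ρ, |u y - T|) (𝓝[>] (0 : ℝ)) (𝓝 0)

set_option linter.unusedSectionVars false
set_option linter.unusedSimpArgs false

/-- average of translates along a segment -/
def segAvg {E : Type*} [NormedAddCommGroup E] [NormedSpace ℝ E] (φ : E → ℝ) (v : E) (y : E) : ℝ :=
  ∫ t in Icc (0:ℝ) 1, φ (y - t • v)

section
variable {E : Type*} [NormedAddCommGroup E] [NormedSpace ℝ E] [MeasurableSpace E] [BorelSpace E]
  [FiniteDimensional ℝ E]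

lemma segAvg_eq_conv {φ : E → ℝ} (hφ : Continuous φ) (v : E) :
    segAvg φ v = (convolution (fun _ : E => (1:ℝ)) φ (ContinuousLinearMap.lsmul ℝ ℝ)
      ((volume.restrict (Icc (0:ℝ) 1)).map (fun t => t • v))) := by
  ext y
  simp only [convolution, segAvg]
  rw [integral_map]
  · simp
  · fun_prop
  · refine Continuous.aestronglyMeasurable ?_
    simp
    fun_prop

lemma segAvg_contDiff {φ : E → ℝ} (hφ : ContDiff ℝ (⊤ : ℕ∞) φ) (hc : HasCompactSupport φ) (v : E) :
    ContDiff ℝ (⊤ : ℕ∞) (segAvg φ v) := by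
  rw [segAvg_eq_conv hφ.continuous]
  refine hc.contDiff_convolution_right _ ?_ hφ
  have : IsFiniteMeasure ((volume.restrict (Icc (0:ℝ) 1)).map (fun t => t • v)) := inferInstance
  exact locallyIntegrable_const _

lemma segAvg_fderiv {φ : E → ℝ} (hφ : ContDiff ℝ (⊤ : ℕ∞) φ) (hc : HasCompactSupport φ) (v y : E) :
    fderiv ℝ (segAvg φ v) y v = φ y - φ (y - v) := by
  have hdiff : DifferentiableAt ℝ (segAvg φ v) y :=
    (segAvg_contDiff hφ hc v).differentiable (by simp) y
  have e1 : HasDerivAt (fun s : ℝ => y + s • v) v 0 := by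
    simpa using ((hasDerivAt_id (0:ℝ)).smul_const v).const_add y
  have e2 : HasDerivAt (fun s : ℝ => segAvg φ v (y + s • v)) (fderiv ℝ (segAvg φ v) y v) 0 := by
    have h0 : HasFDerivAt (segAvg φ v) (fderiv ℝ (segAvg φ v) y) (y + (0:ℝ) • v) := by
      simpa using hdiff.hasFDerivAt
    exact h0.comp_hasDerivAt (0:ℝ) e1
  have hcφ := hφ.continuous
  have hcψ : Continuous (fun τ : ℝ => φ (y + τ • v)) := by fun_prop
  have e3 : (fun s : ℝ => segAvg φ v (y + s • v)) = fun s =>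
      (∫ τ in (0:ℝ)..s, φ (y + τ • v)) - ∫ τ in (0:ℝ)..(s-1), φ (y + τ • v) := by
    ext s
    rw [intervalIntegral.integral_interval_sub_left (hcψ.intervalIntegrable _ _)
      (hcψ.intervalIntegrable _ _)]
    unfold segAvg
    rw [integral_Icc_eq_integral_Ioc, ← intervalIntegral.integral_of_le zero_le_one]
    have := intervalIntegral.integral_comp_sub_left (a := 0) (b := 1) (fun τ : ℝ => φ (y + τ • v)) s
    rw [sub_zero] at this
    rw [← this]
    congr 1
    ext t
    congr 1
    rw [sub_smul]; abel
  have e4 : HasDerivAt (fun s : ℝ => (∫ τ in (0:ℝ)..s, φ (y + τ • v))) (φ (y + (0:ℝ) • v)) 0 :=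
    hcψ.integral_hasStrictDerivAt 0 0 |>.hasDerivAt
  have e5 : HasDerivAt (fun s : ℝ => (∫ τ in (0:ℝ)..(s-1), φ (y + τ • v)))
      (φ (y + ((0:ℝ)-1) • v)) 0 := by
    have := (hcψ.integral_hasStrictDerivAt 0 ((0:ℝ)-1)).hasDerivAt
    exact this.comp_sub_const 0 1
  rw [e3] at e2
  have := e2.unique (e4.sub e5)
  rw [this]
  simp [sub_eq_add_neg]

/-- sweep of a set along a segment -/
def sweep {E : Type*} [NormedAddCommGroup E] [NormedSpace ℝ E] (K : Set E) (v : E) : Set E :=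
  (fun p : E × ℝ => p.1 + p.2 • v) '' (K ×ˢ Icc (0:ℝ) 1)

lemma sweep_compact {K : Set E} (hK : IsCompact K) (v : E) : IsCompact (sweep K v) :=
  (hK.prod isCompact_Icc).image (by fun_prop)

lemma segAvg_support {φ : E → ℝ} (v : E) {y : E} (hy : y ∉ sweep (tsupport φ) v) :
    segAvg φ v y = 0 := by
  unfold segAvg
  rw [setIntegral_eq_zero_of_forall_eq_zero]
  intro t ht
  by_contra h
  exact hy ⟨(y - t • v, t), ⟨subset_tsupport _ h, ht⟩, by simp⟩

lemma segAvg_tsupport {φ : E → ℝ} (hc : HasCompactSupport φ) (v : E) :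
    tsupport (segAvg φ v) ⊆ sweep (tsupport φ) v := by
  refine closure_minimal ?_ (sweep_compact hc v).isClosed
  intro y hy
  by_contra h
  exact hy (segAvg_support v h)

lemma segAvg_hasCompactSupport {φ : E → ℝ} (hc : HasCompactSupport φ) (v : E) :
    HasCompactSupport (segAvg φ v) :=
  (sweep_compact hc v).of_isClosed_subset (isClosed_tsupport _) (segAvg_tsupport hc v)

/-- points whose whole segment stays in `U` -/
def segIn {E : Type*} [NormedAddCommGroup E] [NormedSpace ℝ E] (U : Set E) (v : E) : Set E :=
  {y | ∀ t ∈ Icc (0:ℝ) 1, y + t • v ∈ U}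

lemma segIn_open {U : Set E} (hU : IsOpen U) (v : E) : IsOpen (segIn U v) := by
  rw [isOpen_iff_mem_nhds]
  intro y hy
  have := (isCompact_Icc (a := (0:ℝ)) (b := 1)).eventually_forall_of_forall_eventually
    (x₀ := y) (P := fun z t => z + t • v ∈ U) ?_
  · exact this
  · intro t ht
    have hcont : Continuous (fun p : E × ℝ => p.1 + p.2 • v) := by fun_prop
    exact hcont.continuousAt.eventually_mem (hU.mem_nhds (hy t ht))

lemma sweep_subset {U K : Set E} {v : E} (hK : K ⊆ segIn U v) : sweep K v ⊆ U := by
  rintro _ ⟨⟨y, t⟩, ⟨hy, ht⟩, rfl⟩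
  exact hK hy t ht

lemma shear_integrable {μ : Measure E} [μ.IsAddHaarMeasure] {H : E → ℝ} (hH : Measurable H) {K : Set E} (hK : IsCompact K) (v : E)
    (hi : IntegrableOn H (sweep K v) μ) :
    Integrable (fun p : E × ℝ => H (p.1 + p.2 • v))
      ((μ.restrict K).prod (volume.restrict (Icc (0:ℝ) 1))) := by
  have hm : Measurable (fun p : E × ℝ => H (p.1 + p.2 • v)) := hH.comp (by fun_prop)
  refine ⟨hm.aestronglyMeasurable, ?_⟩
  unfold HasFiniteIntegral
  rw [lintegral_prod_symm' _ hm.enorm]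
  have hb : ∀ t ∈ Icc (0:ℝ) 1, ∫⁻ y in K, ‖H (y + t • v)‖ₑ ∂μ ≤ ∫⁻ y in sweep K v, ‖H y‖ₑ ∂μ := by
    intro t ht
    rw [← lintegral_indicator hK.measurableSet, ← lintegral_indicator (sweep_compact hK v).measurableSet,
      ← lintegral_add_right_eq_self ((sweep K v).indicator fun y => ‖H y‖ₑ) (t • v)]
    refine lintegral_mono fun y => ?_
    by_cases hy : y ∈ K
    · have : y + t • v ∈ sweep K v := ⟨(y, t), ⟨hy, ht⟩, rfl⟩
      simp [hy, this]
    · simp [hy]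
  refine (setLIntegral_mono' measurableSet_Icc hb).trans_lt ?_
  simp
  exact hi.2
end

section
variable {E : Type*} [NormedAddCommGroup E] [NormedSpace ℝ E] [MeasurableSpace E] [BorelSpace E]
  [FiniteDimensional ℝ E]

lemma ftc_ae {μ : Measure E} [μ.IsAddHaarMeasure] {u H : E → ℝ} {U : Set E} (hU : IsOpen U) (v : E)
    (hu : LocallyIntegrable u μ) (hH : Measurable H)
    (hHi : ∀ K, IsCompact K → K ⊆ U → IntegrableOn H K μ)
    (hw : ∀ φ : E → ℝ, ContDiff ℝ (⊤ : ℕ∞) φ → HasCompactSupport φ → tsupport φ ⊆ U →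
      ∫ y, u y * fderiv ℝ φ y v ∂μ = - ∫ y, H y * φ y ∂μ) :
    ∀ᵐ y ∂μ, y ∈ segIn U v → u (y + v) - u y = ∫ t in Icc (0:ℝ) 1, H (y + t • v) := by
  have huv : LocallyIntegrable (fun y => u (y + v)) μ := by
    rw [locallyIntegrable_iff]
    intro K hK
    have h1 := hu.integrableOn_isCompact (hK.image (continuous_add_const v))
    have h2 := (measurePreserving_add_right μ v).integrableOn_comp_preimage
      (Homeomorph.addRight v).measurableEmbedding (f := u) (s := (fun y => y + v) '' K)
    have h3 : (fun y => y + v) ⁻¹' ((fun y => y + v) '' K) = K :=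
      preimage_image_eq _ (add_left_injective v)
    rw [h3] at h2
    exact h2.2 h1
  have hI : LocallyIntegrableOn (fun y => ∫ t in Icc (0:ℝ) 1, H (y + t • v)) (segIn U v) μ := by
    rw [locallyIntegrableOn_iff (segIn_open hU v).isLocallyClosed]
    intro K hKU hK
    exact (shear_integrable hH hK v (hHi _ (sweep_compact hK v) (sweep_subset hKU))).integral_prod_left
  have hF : LocallyIntegrableOn (fun y => (u (y + v) - u y) - ∫ t in Icc (0:ℝ) 1, H (y + t • v))
      (segIn U v) μ := ((huv.sub hu).locallyIntegrableOn _).sub hI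
  have key := (segIn_open hU v).ae_eq_zero_of_integral_contDiff_smul_eq_zero hF ?_
  · filter_upwards [key] with y hy hyU
    exact sub_eq_zero.1 (hy hyU)
  intro φ hφ hc hsupp
  have hcφ := hφ.continuous
  set K := tsupport φ with hKdef
  have hK : IsCompact K := hc
  have hsw : sweep K v ⊆ U := sweep_subset hsupp
  have hprod := shear_integrable hH hK v (hHi _ (sweep_compact hK v) hsw)
  obtain ⟨M, hM⟩ := hc.exists_bound_of_continuous hcφ
  have hi1 : Integrable (fun y => φ y * u (y + v)) μ := 
    huv.integrable_smul_left_of_hasCompactSupport hcφ hc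
  have hi2 : Integrable (fun y => φ y * u y) μ := 
    hu.integrable_smul_left_of_hasCompactSupport hcφ hc
  have hprod2 : Integrable (fun p : E × ℝ => φ p.1 * H (p.1 + p.2 • v))
      (μ.prod (volume.restrict (Icc (0:ℝ) 1))) := by
    have h1 : IntegrableOn (fun p : E × ℝ => φ p.1 * H (p.1 + p.2 • v)) (K ×ˢ univ)
        (μ.prod (volume.restrict (Icc (0:ℝ) 1))) := by
      rw [IntegrableOn, ← Measure.prod_restrict, Measure.restrict_univ]
      refine hprod.bdd_mul (c := M) (by fun_prop) ?_
      exact Eventually.of_forall fun p => hM _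
    rw [integrableOn_iff_integrable_of_support_subset] at h1
    · exact h1
    · intro p hp
      refine ⟨?_, mem_univ _⟩
      by_contra h
      exact hp (by simp [image_eq_zero_of_notMem_tsupport h])
  have hprod3 : Integrable (fun p : E × ℝ => φ (p.1 - p.2 • v) * H p.1)
      (μ.prod (volume.restrict (Icc (0:ℝ) 1))) := by
    have h0 : Integrable (fun p : E × ℝ => H p.1)
        ((μ.restrict (sweep K v)).prod (volume.restrict (Icc (0:ℝ) 1))) :=
      (hHi _ (sweep_compact hK v) hsw).integrable.comp_fst _
    have h1 : IntegrableOn (fun p : E × ℝ => φ (p.1 - p.2 • v) * H p.1) ((sweep K v) ×ˢ Icc (0:ℝ) 1)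
        (μ.prod (volume)) := by
      rw [IntegrableOn, ← Measure.prod_restrict]
      refine h0.bdd_mul (c := M) (by fun_prop) ?_
      exact Eventually.of_forall fun p => hM _
    have h2 : IntegrableOn (fun p : E × ℝ => φ (p.1 - p.2 • v) * H p.1) (univ ×ˢ Icc (0:ℝ) 1)
        (μ.prod (volume)) := by
      refine h1.of_forall_sdiff_eq_zero (MeasurableSet.univ.prod measurableSet_Icc) ?_
      rintro ⟨y, t⟩ ⟨⟨-, ht⟩, hp⟩
      have : y - t • v ∉ K := fun h => hp ⟨⟨(y - t • v, t), ⟨h, ht⟩, by simp⟩, ht⟩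
      simp [image_eq_zero_of_notMem_tsupport this]
    rw [IntegrableOn, ← Measure.prod_restrict, Measure.restrict_univ] at h2
    exact h2
  have hi3 : Integrable (fun y => φ y * ∫ t in Icc (0:ℝ) 1, H (y + t • v)) μ := by
    have := hprod2.integral_prod_left
    simpa only [integral_const_mul] using this
  have e1 : ∫ y, (φ y * ∫ t in Icc (0:ℝ) 1, H (y + t • v)) ∂μ = ∫ y, H y * segAvg φ v y ∂μ := by
    calc ∫ y, (φ y * ∫ t in Icc (0:ℝ) 1, H (y + t • v)) ∂μ
        = ∫ y, (∫ t in Icc (0:ℝ) 1, φ y * H (y + t • v)) ∂μ := by simp only [integral_const_mul]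
      _ = ∫ t in Icc (0:ℝ) 1, (∫ y, φ y * H (y + t • v) ∂μ) := integral_integral_swap hprod2
      _ = ∫ t in Icc (0:ℝ) 1, (∫ y, φ (y - t • v) * H y ∂μ) := by
          congr 1; ext t
          rw [← integral_add_right_eq_self (fun y => φ (y - t • v) * H y) (t • v)]
          simp
      _ = ∫ y, (∫ t in Icc (0:ℝ) 1, φ (y - t • v) * H y) ∂μ := (integral_integral_swap hprod3).symm
      _ = ∫ y, H y * segAvg φ v y ∂μ := by
          congr 1; ext y
          rw [integral_mul_const, mul_comm]; rfl
  have e2 := hw _ (segAvg_contDiff hφ hc v) (segAvg_hasCompactSupport hc v)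
    ((segAvg_tsupport hc v).trans hsw)
  simp only [segAvg_fderiv hφ hc] at e2
  have hi4 : Integrable (fun y => φ (y - v) * u y) μ := by
    have := hi1.comp_add_right (-v)
    simpa [sub_eq_add_neg] using this
  have e3 : ∫ y, φ y * u (y + v) ∂μ = ∫ y, φ (y - v) * u y ∂μ := by
    rw [← integral_add_right_eq_self (fun y => φ (y - v) * u y) v]
    simp
  have e4 : ∫ y, u y * (φ y - φ (y - v)) ∂μ = ∫ y, φ y * u y ∂μ - ∫ y, φ (y - v) * u y ∂μ := by
    rw [← integral_sub hi2 hi4]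
    congr 1; ext y; ring
  simp only [smul_eq_mul, mul_sub]
  have hi12 : Integrable (fun y => φ y * u (y + v) - φ y * u y) μ := hi1.sub hi2
  rw [integral_sub hi12 hi3, integral_sub hi1 hi2, e1, e3]
  linarith
end

lemma null_lines {n : ℕ} {Γ : Set (EuclideanSpace ℝ (Fin (n+1)))} (hΓ : μH[(n:ℝ)] Γ = 0)
    {v : EuclideanSpace ℝ (Fin (n+1))} (hv : v ≠ 0) :
    ∀ᵐ y : EuclideanSpace ℝ (Fin (n+1)), ∀ t : ℝ, y + t • v ∉ Γ := by
  have hf : Module.finrank ℝ (EuclideanSpace ℝ (Fin (n+1)) ⧸ (ℝ ∙ v)) = Module.finrank ℝ (Fin n → ℝ) := by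
    have h1 := Submodule.finrank_quotient_add_finrank (ℝ ∙ v)
    rw [finrank_span_singleton hv] at h1
    rw [finrank_euclideanSpace_fin] at h1
    rw [Module.finrank_fin_fun]
    exact Nat.succ_injective h1
  let e := LinearEquiv.ofFinrankEq _ _ hf
  let L : EuclideanSpace ℝ (Fin (n+1)) →ₗ[ℝ] (Fin n → ℝ) := e.toLinearMap ∘ₗ (ℝ ∙ v).mkQ
  have hL : Function.Surjective L := e.surjective.comp (Submodule.mkQ_surjective _)
  have hLv : L v = 0 := by
    have : (ℝ ∙ v).mkQ v = 0 := by simp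
    simp [L, this]
  let L' : EuclideanSpace ℝ (Fin (n+1)) →L[ℝ] (Fin n → ℝ) := L.toContinuousLinearMap
  have h0 : volume (L '' Γ) = 0 := by
    rw [← hausdorffMeasure_pi_real]
    have := L'.lipschitz.hausdorffMeasure_image_le (d := (n:ℝ)) (by positivity) Γ
    rw [hΓ, mul_zero] at this
    rw [Fintype.card_fin]
    exact le_antisymm this bot_le
  obtain ⟨c, -, hc⟩ := L.exists_map_addHaar_eq_smul_addHaar volume (volume : Measure (Fin n → ℝ)) hL
  have h1 : (volume.map L) (L '' Γ) = 0 := by rw [hc]; simp [h0]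
  have hq : ∀ᵐ y : EuclideanSpace ℝ (Fin (n+1)), L y ∉ L '' Γ := by
    have hae : ∀ᵐ z ∂(volume.map L), z ∉ L '' Γ := by
      rw [ae_iff]; simpa only [not_not, ofPred_mem_eq] using h1
    exact ae_of_ae_map L'.continuous.measurable.aemeasurable hae
  filter_upwards [hq] with y hy t ht
  exact hy ⟨_, ht, by simp [hLv]⟩

lemma poincare {E : Type*} [NormedAddCommGroup E] [NormedSpace ℝ E] [MeasurableSpace E] [BorelSpace E]
    [FiniteDimensional ℝ E] {μ : Measure E} [μ.IsAddHaarMeasure] {u : E → ℝ} {g : E → ℝ≥0∞}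
    (hu : Measurable u) (hg : Measurable g)
    (h : ∀ v, ∀ᵐ y ∂μ, ‖u (y + v) - u y‖ₑ ≤ ‖v‖ₑ * ∫⁻ t in Icc (0:ℝ) 1, g (y + t • v))
    (x : E) (r : ℝ) :
    ∫⁻ y in ball x r, ∫⁻ z in ball x r, ‖u z - u y‖ₑ ∂μ ∂μ ≤
      μ (ball 0 (2 * r)) * (ENNReal.ofReal (2 * r) * ∫⁻ y in ball x r, g y ∂μ) := by
  set B := ball x r
  have hB : MeasurableSet B := measurableSet_ball
  have hgB : Measurable (B.indicator g) := hg.indicator hB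
  -- the fixed direction estimate
  have hv : ∀ v, ∫⁻ y, B.indicator 1 y * (B.indicator 1 (y + v) * ‖u (y + v) - u y‖ₑ) ∂μ ≤
      (ball (0:E) (2*r)).indicator (fun _ => ENNReal.ofReal (2 * r) * ∫⁻ y in B, g y ∂μ) v := by
    intro v
    by_cases hvr : v ∈ ball (0:E) (2*r)
    · rw [indicator_of_mem hvr]
      have hvr' : ‖v‖ₑ ≤ ENNReal.ofReal (2*r) := by
        rw [← ofReal_norm]
        exact ENNReal.ofReal_le_ofReal (by simpa using (mem_ball_zero_iff.1 hvr).le)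
      calc ∫⁻ y, B.indicator 1 y * (B.indicator 1 (y + v) * ‖u (y + v) - u y‖ₑ) ∂μ
          ≤ ∫⁻ y, (‖v‖ₑ * ∫⁻ t in Icc (0:ℝ) 1, B.indicator g (y + t • v)) ∂μ := by
            refine lintegral_mono_ae ?_
            filter_upwards [h v] with y hy
            by_cases h1 : y ∈ B
            · by_cases h2 : y + v ∈ B
              · simp only [h1, h2, indicator_of_mem, Pi.one_apply, one_mul]
                refine hy.trans ?_
                gcongr ‖v‖ₑ * ?_
                refine setLIntegral_mono' measurableSet_Icc fun t ht => ?_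
                have : y + t • v ∈ B := by
                  have := (convex_ball x r).add_smul_sub_mem h1 h2 ht
                  rwa [add_sub_cancel_left] at this
                rw [indicator_of_mem this]
              · simp [h2]
            · simp [h1]
        _ = ‖v‖ₑ * ∫⁻ t in Icc (0:ℝ) 1, ∫⁻ y, B.indicator g (y + t • v) ∂μ := by
            have hm : Measurable (fun p : E × ℝ => B.indicator g (p.1 + p.2 • v)) :=
              hgB.comp (by fun_prop)
            rw [lintegral_const_mul _ (hm.lintegral_prod_right')]
            rw [lintegral_lintegral_swap hm.aemeasurable]
        _ = ‖v‖ₑ * ∫⁻ y in B, g y ∂μ := by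
            simp only [lintegral_add_right_eq_self]
            simp [lintegral_indicator hB]
        _ ≤ _ := by gcongr
    · rw [indicator_of_notMem hvr]
      refine le_of_eq ?_
      rw [lintegral_eq_zero_iff']
      · refine Eventually.of_forall fun y => ?_
        by_cases h1 : y ∈ B
        · by_cases h2 : y + v ∈ B
          · exfalso; apply hvr
            rw [mem_ball_zero_iff]
            have a1 : dist y x < r := h1
            have a2 : dist (y+v) x < r := h2
            have a3 := dist_triangle_right (y+v) y x
            rw [dist_eq_norm, add_sub_cancel_left] at a3
            linarith
          · simp [h2]
        · simp [h1]
      · have : Measurable (B.indicator (1 : E → ℝ≥0∞)) := measurable_one.indicator hB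
        fun_prop
  have hm1 : Measurable (B.indicator (1 : E → ℝ≥0∞)) := measurable_one.indicator hB
  calc ∫⁻ y in B, ∫⁻ z in B, ‖u z - u y‖ₑ ∂μ ∂μ
      = ∫⁻ y, ∫⁻ v, B.indicator 1 y * (B.indicator 1 (y + v) * ‖u (y + v) - u y‖ₑ) ∂μ ∂μ := by
        rw [← lintegral_indicator hB]
        congr 1; ext y
        by_cases h1 : y ∈ B
        · simp only [h1, indicator_of_mem, Pi.one_apply, one_mul]
          rw [lintegral_add_left_eq_self (fun z => B.indicator 1 z * ‖u z - u y‖ₑ) y,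
            ← lintegral_indicator hB]
          congr 1; ext z
          by_cases h2 : z ∈ B <;> simp [h2]
        · simp [h1]
    _ = ∫⁻ v, ∫⁻ y, B.indicator 1 y * (B.indicator 1 (y + v) * ‖u (y + v) - u y‖ₑ) ∂μ ∂μ := by
        rw [lintegral_lintegral_swap]
        apply Measurable.aemeasurable
        unfold Function.uncurry
        fun_prop
    _ ≤ ∫⁻ v, (ball (0:E) (2*r)).indicator (fun _ => ENNReal.ofReal (2 * r) * ∫⁻ y in B, g y ∂μ) v ∂μ :=
        lintegral_mono hv
    _ = _ := by
        rw [lintegral_indicator measurableSet_ball, setLIntegral_const, mul_comm]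

lemma trace_of_decay {E : Type*} [NormedAddCommGroup E] [NormedSpace ℝ E] [MeasurableSpace E] [BorelSpace E]
    [FiniteDimensional ℝ E] {μ : Measure E} [μ.IsAddHaarMeasure] {u : E → ℝ}
    (hli : LocallyIntegrable u μ) (x : E) (b : ℕ → ℝ) (hb0 : ∀ k, 0 ≤ b k)
    (hb : Summable b)
    (h : ∀ k, ∫⁻ y in ball x ((1/2:ℝ)^k), ∫⁻ z in ball x ((1/2:ℝ)^k), ‖u z - u y‖ₑ ∂μ ∂μ ≤
      ENNReal.ofReal (b k) * (μ (ball x ((1/2:ℝ)^k)) * μ (ball x ((1/2:ℝ)^k)))) :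
    ∃ T : ℝ, Tendsto (fun ρ : ℝ => ⨍ y in ball x ρ, |u y - T| ∂μ) (𝓝[>] (0 : ℝ)) (𝓝 0) ∧
      Tendsto (fun r : ℝ => ⨍ y in ball x r, u y ∂μ) (𝓝[>] (0 : ℝ)) (𝓝 T) := by
  have hint : ∀ r, IntegrableOn u (ball x r) μ := fun r =>
    (hli.integrableOn_isCompact (isCompact_closedBall x r)).mono_set ball_subset_closedBall
  have hfin : ∀ r, μ (ball x r) ≠ ⊤ := fun r => measure_ball_lt_top.ne
  have hpos : ∀ r, 0 < r → μ (ball x r) ≠ 0 := fun r hr => (measure_ball_pos μ x hr).ne'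
  have hposr : ∀ r, 0 < r → 0 < μ.real (ball x r) := fun r hr =>
    ENNReal.toReal_pos (hpos r hr) (hfin r)
  have hintc : ∀ r (c : ℝ), IntegrableOn (fun y => u y - c) (ball x r) μ := fun r c =>
    (hint r).sub (integrableOn_const (hfin r))
  have hintca : ∀ r (c : ℝ), IntegrableOn (fun y => |u y - c|) (ball x r) μ := fun r c =>
    (hintc r c).abs
  set N := Module.finrank ℝ E
  have hr : ∀ k : ℕ, (0:ℝ) < (1/2)^k := fun k => by positivity
  have hvol : ∀ k : ℕ, μ.real (ball x ((1/2:ℝ)^k)) = 2^N * μ.real (ball x ((1/2:ℝ)^(k+1))) := by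
    intro k
    simp only [Measure.real]
    rw [Measure.addHaar_ball_of_pos μ x (hr k), Measure.addHaar_ball_of_pos μ x (hr (k+1))]
    rw [ENNReal.toReal_mul, ENNReal.toReal_mul, ENNReal.toReal_ofReal (by positivity),
      ENNReal.toReal_ofReal (by positivity), ← mul_assoc, ← mul_pow]
    congr 2
    rw [pow_succ]; ring
  let m : ℕ → ℝ := fun k => ⨍ y in ball x ((1/2:ℝ)^k), u y ∂μ
  have h1 : ∀ k, ∫ y in ball x ((1/2:ℝ)^k), |u y - m k| ∂μ ≤ b k * μ.real (ball x ((1/2:ℝ)^k)) := by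
    intro k
    set B := ball x ((1/2:ℝ)^k)
    have hB0 : μ B ≠ 0 := hpos _ (hr k)
    have hBt : μ B ≠ ⊤ := hfin _
    have hp : ∀ y, ‖u y - m k‖ₑ ≤ (μ B)⁻¹ * ∫⁻ z in B, ‖u z - u y‖ₑ ∂μ := by
      intro y
      have e : m k - u y = (μ.real B)⁻¹ * ∫ z in B, (u z - u y) ∂μ := by
        have hm : m k = (μ.real B)⁻¹ * ∫ z in B, u z ∂μ := setAverage_eq _ _ _
        have hne : μ.real B ≠ 0 := (hposr _ (hr k)).ne'
        have hs : ∫ z in B, (u z - u y) ∂μ = ∫ z in B, u z ∂μ - μ.real B * u y := by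
          rw [integral_sub (hint _) (integrableOn_const hBt), setIntegral_const, smul_eq_mul]
        rw [hm, hs]
        field_simp
      rw [enorm_sub_rev, e, enorm_mul]
      have e2 : ‖(μ.real B)⁻¹‖ₑ = (μ B)⁻¹ := by
        rw [enorm_inv (hposr _ (hr k)).ne', Real.enorm_eq_ofReal measureReal_nonneg, ofReal_measureReal hBt]
      rw [e2]
      gcongr
      exact enorm_integral_le_lintegral_enorm _
    have h2 : ∫⁻ y in B, ‖u y - m k‖ₑ ∂μ ≤ ENNReal.ofReal (b k) * μ B := by
      calc ∫⁻ y in B, ‖u y - m k‖ₑ ∂μ ≤ ∫⁻ y in B, (μ B)⁻¹ * ∫⁻ z in B, ‖u z - u y‖ₑ ∂μ ∂μ :=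
            lintegral_mono hp
        _ = (μ B)⁻¹ * ∫⁻ y in B, ∫⁻ z in B, ‖u z - u y‖ₑ ∂μ ∂μ :=
            lintegral_const_mul' _ _ (ENNReal.inv_ne_top.2 hB0)
        _ ≤ (μ B)⁻¹ * (ENNReal.ofReal (b k) * (μ B * μ B)) := by gcongr; exact h k
        _ = ENNReal.ofReal (b k) * μ B * ((μ B)⁻¹ * μ B) := by ring
        _ = _ := by rw [ENNReal.inv_mul_cancel hB0 hBt, mul_one]
    have h3 : ∫ y in B, |u y - m k| ∂μ = (∫⁻ y in B, ‖u y - m k‖ₑ ∂μ).toReal :=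
      integral_norm_eq_lintegral_enorm (hintc _ _).aestronglyMeasurable
    rw [h3]
    refine (ENNReal.toReal_mono (by finiteness) h2).trans_eq ?_
    rw [ENNReal.toReal_mul, ENNReal.toReal_ofReal (hb0 k)]; rfl
  have hbound : ∀ r (c : ℝ), 0 < r → |(⨍ y in ball x r, u y ∂μ) - c| ≤ ⨍ y in ball x r, |u y - c| ∂μ := by
    intro r c hr0
    have e : (⨍ y in ball x r, u y ∂μ) - c = ⨍ y in ball x r, (u y - c) ∂μ := by
      simp only [setAverage_eq, smul_eq_mul]
      rw [integral_sub (hint _) (integrableOn_const (hfin r))]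
      simp only [setIntegral_const, smul_eq_mul]
      have := (hposr _ hr0).ne'
      field_simp
    rw [e]
    simp only [setAverage_eq, smul_eq_mul, abs_mul]
    rw [abs_of_pos (inv_pos.2 (hposr _ hr0))]
    gcongr
    exact abs_integral_le_integral_abs
  have hcomp : ∀ k r (c : ℝ), (1/2:ℝ)^(k+1) ≤ r → r ≤ (1/2)^k →
      ⨍ y in ball x r, |u y - c| ∂μ ≤
        2^N * ((μ.real (ball x ((1/2:ℝ)^k)))⁻¹ * ∫ y in ball x ((1/2:ℝ)^k), |u y - c| ∂μ) := by
    intro k r c h1 h2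
    simp only [setAverage_eq, smul_eq_mul]
    have h3 : ∫ y in ball x r, |u y - c| ∂μ ≤ ∫ y in ball x ((1/2:ℝ)^k), |u y - c| ∂μ :=
      setIntegral_mono_set (hintca _ c) (Eventually.of_forall fun _ => abs_nonneg _)
        (ball_subset_ball h2).eventuallyLE
    have h4 : μ.real (ball x ((1/2:ℝ)^(k+1))) ≤ μ.real (ball x r) :=
      measureReal_mono (ball_subset_ball h1) (hfin r)
    have h5 : 0 ≤ ∫ y in ball x ((1/2:ℝ)^k), |u y - c| ∂μ := integral_nonneg fun _ => abs_nonneg _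
    have p1 := hposr _ (hr (k+1))
    rw [hvol k]
    calc (μ.real (ball x r))⁻¹ * ∫ y in ball x r, |u y - c| ∂μ
        ≤ (μ.real (ball x ((1/2:ℝ)^(k+1))))⁻¹ * ∫ y in ball x ((1/2:ℝ)^k), |u y - c| ∂μ := by gcongr
      _ = _ := by field_simp
  have h1' : ∀ k, (μ.real (ball x ((1/2:ℝ)^k)))⁻¹ * ∫ y in ball x ((1/2:ℝ)^k), |u y - m k| ∂μ ≤ b k := by
    intro k
    rw [inv_mul_le_iff₀ (hposr _ (hr k)), mul_comm]
    exact h1 k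
  have hstep : ∀ k, dist (m k) (m (k+1)) ≤ 2^N * b k := by
    intro k
    rw [dist_comm, Real.dist_eq]
    refine (hbound _ (m k) (hr (k+1))).trans ((hcomp k _ _ le_rfl ?_).trans ?_)
    · exact pow_le_pow_of_le_one (by norm_num) (by norm_num) (Nat.le_succ k)
    · gcongr; exact h1' k
  have hcau : CauchySeq m := cauchySeq_of_dist_le_of_summable _ hstep (hb.mul_left _)
  obtain ⟨T, hT⟩ := cauchySeq_tendsto_of_complete hcau
  refine ⟨T, ?_⟩
  have hlim : Tendsto (fun k => 2^N * (b k + |m k - T|)) atTop (𝓝 0) := by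
    have : Tendsto (fun k => |m k - T|) atTop (𝓝 0) := by
      have := (hT.sub_const T).abs
      simpa using this
    simpa using (hb.tendsto_atTop_zero.add this).const_mul (2^N)
  have hk : ∀ k, (μ.real (ball x ((1/2:ℝ)^k)))⁻¹ * ∫ y in ball x ((1/2:ℝ)^k), |u y - T| ∂μ ≤ b k + |m k - T| := by
    intro k
    have p := hposr _ (hr k)
    have : ∫ y in ball x ((1/2:ℝ)^k), |u y - T| ∂μ ≤
        ∫ y in ball x ((1/2:ℝ)^k), |u y - m k| ∂μ + |m k - T| * μ.real (ball x ((1/2:ℝ)^k)) := by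
      have e : |m k - T| * μ.real (ball x ((1/2:ℝ)^k)) = ∫ y in ball x ((1/2:ℝ)^k), |m k - T| ∂μ := by
        simp [mul_comm]
      rw [e, ← integral_add (hintca _ _) (integrableOn_const (hfin _))]
      refine setIntegral_mono (hintca _ _) ((hintca _ _).add (integrableOn_const (hfin _))) fun y => ?_
      exact abs_sub_le _ _ _
    rw [inv_mul_le_iff₀ p]
    have := h1 k
    nlinarith
  have main : Tendsto (fun ρ : ℝ => ⨍ y in ball x ρ, |u y - T| ∂μ) (𝓝[>] (0 : ℝ)) (𝓝 0) := by
    rw [Metric.tendsto_nhds]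
    intro ε hε
    obtain ⟨K, hK⟩ := (Metric.tendsto_atTop.1 hlim) ε hε
    have : Ioo (0:ℝ) ((1/2)^K) ∈ 𝓝[>] (0:ℝ) := Ioo_mem_nhdsGT (hr K)
    filter_upwards [this] with r hrr
    have hle1 : r ≤ 1 := hrr.2.le.trans (pow_le_one₀ (by norm_num) (by norm_num))
    obtain ⟨k, hk1, hk2⟩ := exists_nat_pow_near_of_lt_one hrr.1 hle1 (by norm_num : (0:ℝ) < 1/2) (by norm_num)
    have hkK : K ≤ k := by
      by_contra hlt
      have : (1/2:ℝ)^K ≤ (1/2)^(k+1) := pow_le_pow_of_le_one (by norm_num) (by norm_num) (by omega)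
      linarith [hrr.2]
    have e1 := hK k hkK
    rw [Real.dist_eq, sub_zero] at e1 ⊢
    have e2 := (hcomp k r T hk1.le hk2).trans (mul_le_mul_of_nonneg_left (hk k) (by positivity))
    have e3 : 0 ≤ ⨍ y in ball x r, |u y - T| ∂μ := by
      simp only [setAverage_eq, smul_eq_mul]
      exact mul_nonneg (inv_nonneg.2 measureReal_nonneg) (integral_nonneg fun _ => abs_nonneg _)
    rw [abs_of_nonneg e3]
    exact e2.trans_lt ((le_abs_self _).trans_lt e1)
  refine ⟨main, ?_⟩
  rw [tendsto_iff_dist_tendsto_zero]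
  refine squeeze_zero' (Eventually.of_forall fun _ => dist_nonneg) ?_ main
  filter_upwards [self_mem_nhdsWithin] with r hr0
  exact hbound r T hr0

lemma energy_decay {E : Type*} [NormedAddCommGroup E] [NormedSpace ℝ E] [MeasurableSpace E] [BorelSpace E]
    [FiniteDimensional ℝ E] {μ : Measure E} [SFinite μ] {σ : Measure E} [SFinite σ]
    {Q : E → ℝ≥0∞} (hQ : Measurable Q) (hQf : ∫⁻ y, Q y ∂μ ≠ ⊤) {C d : ℝ} (hC : 0 ≤ C)
    (hσ : ∀ y, ∀ r, 0 < r → σ (ball y r) ≤ ENNReal.ofReal (C * r ^ d)) :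
    ∀ᵐ x ∂σ, ∃ M : ℝ, 0 ≤ M ∧ ∀ k : ℕ, ∫⁻ y in ball x ((1/2:ℝ)^k), Q y ∂μ ≤
      ENNReal.ofReal (M * ((1/2:ℝ)^k) ^ (d - 1/2)) := by
  have hr : ∀ k : ℕ, (0:ℝ) < (1/2)^k := fun k => by positivity
  have hms : ∀ r : ℝ, MeasurableSet {p : E × E | dist p.2 p.1 < r} := fun r =>
    (isOpen_lt (by fun_prop) continuous_const).measurableSet
  have hm : ∀ r : ℝ, Measurable (fun p : E × E => {p : E × E | dist p.2 p.1 < r}.indicator (fun p => Q p.2) p) :=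
    fun r => (hQ.comp measurable_snd).indicator (hms r)
  have heq : ∀ (r : ℝ) x, ∫⁻ y in ball x r, Q y ∂μ =
      ∫⁻ y, {p : E × E | dist p.2 p.1 < r}.indicator (fun p => Q p.2) (x, y) ∂μ := by
    intro r x
    rw [← lintegral_indicator measurableSet_ball]
    rfl
  have hmE : ∀ r : ℝ, Measurable (fun x => ∫⁻ y in ball x r, Q y ∂μ) := by
    intro r
    simp only [heq]
    exact (hm r).lintegral_prod_right'
  have hE : ∀ r : ℝ, 0 < r → ∫⁻ x, (∫⁻ y in ball x r, Q y ∂μ) ∂σ ≤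
      ENNReal.ofReal (C * r ^ d) * ∫⁻ y, Q y ∂μ := by
    intro r hr0
    simp only [heq]
    rw [lintegral_lintegral_swap (hm r).aemeasurable, ← lintegral_const_mul _ hQ]
    refine lintegral_mono fun y => ?_
    calc ∫⁻ x, {p : E × E | dist p.2 p.1 < r}.indicator (fun p => Q p.2) (x, y) ∂σ
        = ∫⁻ x in ball y r, Q y ∂σ := by
          rw [← lintegral_indicator measurableSet_ball]
          congr 1; ext x
          simp [indicator, dist_comm]
      _ ≤ _ := by
          rw [setLIntegral_const, mul_comm]
          gcongr
          exact hσ y r hr0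
  let c : ℕ → ℝ≥0∞ := fun k => ENNReal.ofReal (((1/2:ℝ)^k) ^ (1/2 - d))
  have hsum : ∫⁻ x, ∑' k, c k * ∫⁻ y in ball x ((1/2:ℝ)^k), Q y ∂μ ∂σ ≠ ⊤ := by
    rw [lintegral_tsum (fun k => ((hmE _).const_mul _).aemeasurable)]
    simp only [lintegral_const_mul _ (hmE _)]
    have hle : ∀ k, c k * ∫⁻ x, (∫⁻ y in ball x ((1/2:ℝ)^k), Q y ∂μ) ∂σ ≤
        ENNReal.ofReal (C * ((1/2:ℝ)^(1/2:ℝ)) ^ k) * ∫⁻ y, Q y ∂μ := by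
      intro k
      calc c k * ∫⁻ x, (∫⁻ y in ball x ((1/2:ℝ)^k), Q y ∂μ) ∂σ
          ≤ c k * (ENNReal.ofReal (C * ((1/2:ℝ)^k) ^ d) * ∫⁻ y, Q y ∂μ) := by
            gcongr; exact hE _ (hr k)
        _ = _ := by
            rw [← mul_assoc]
            congr 1
            simp only [c]
            rw [← ENNReal.ofReal_mul (by positivity)]
            congr 1
            rw [mul_left_comm, ← Real.rpow_add (hr k)]
            congr 1
            rw [← Real.rpow_natCast, ← Real.rpow_natCast, ← Real.rpow_mul (by norm_num), ← Real.rpow_mul (by norm_num)]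
            congr 1; ring
    refine ne_top_of_le_ne_top ?_ (ENNReal.tsum_le_tsum hle)
    rw [ENNReal.tsum_mul_right]
    refine ENNReal.mul_ne_top ?_ hQf
    have hs : Summable (fun k : ℕ => C * ((1/2:ℝ)^(1/2:ℝ)) ^ k) := by
      refine (summable_geometric_of_lt_one (by positivity) ?_).mul_left _
      exact Real.rpow_lt_one (by norm_num) (by norm_num) (by norm_num)
    exact hs.tsum_ofReal_ne_top
  have hmF : Measurable (fun x => ∑' k, c k * ∫⁻ y in ball x ((1/2:ℝ)^k), Q y ∂μ) :=
    Measurable.tsum fun k => (hmE _).const_mul _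
  filter_upwards [ae_lt_top hmF hsum] with x hx
  refine ⟨(∑' k, c k * ∫⁻ y in ball x ((1/2:ℝ)^k), Q y ∂μ).toReal, ENNReal.toReal_nonneg, fun k => ?_⟩
  rw [ENNReal.ofReal_mul ENNReal.toReal_nonneg, ENNReal.ofReal_toReal hx.ne]
  calc ∫⁻ y in ball x ((1/2:ℝ)^k), Q y ∂μ
      = (c k * ∫⁻ y in ball x ((1/2:ℝ)^k), Q y ∂μ) * ENNReal.ofReal (((1/2:ℝ)^k) ^ (d - 1/2)) := by
        rw [mul_right_comm]
        simp only [c]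
        rw [← ENNReal.ofReal_mul (by positivity), ← Real.rpow_add (hr k)]
        simp
    _ ≤ _ := by
        gcongr
        exact ENNReal.le_tsum k

/-- `ℓ¹` size of the gradient -/
def gsum {n : ℕ} (G : EuclideanSpace ℝ (Fin n) → Fin n → ℝ) (y : EuclideanSpace ℝ (Fin n)) : ℝ≥0∞ :=
  ∑ i, ‖G y i‖ₑ

lemma gbound {n : ℕ} {d : ℝ} (hdn : d < (n : ℝ) - 1) {Γ : Set (EuclideanSpace ℝ (Fin n))}
    (hΓ : IsClosed Γ) {G : EuclideanSpace ℝ (Fin n) → Fin n → ℝ} (hG0 : ∀ y ∈ Γ, ∀ i, G y i = 0)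
    {x : EuclideanSpace ℝ (Fin n)} (hx : x ∈ Γ) {r t : ℝ} (hr : 0 < r) (ht : 0 < t) :
    ∫⁻ y in ball x r, gsum G y ≤
      ENNReal.ofReal t * (∫⁻ y in ball x r, ENNReal.ofReal ((∑ i, G y i ^ 2) * wt n d Γ y)) +
        ENNReal.ofReal (n * t⁻¹ * r ^ ((n:ℝ) - 1 - d)) * volume (ball x r) := by
  have hp : ∀ y ∈ ball x r, gsum G y ≤ ENNReal.ofReal t * ENNReal.ofReal ((∑ i, G y i ^ 2) * wt n d Γ y)
      + ENNReal.ofReal (n * t⁻¹ * r ^ ((n:ℝ) - 1 - d)) := by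
    intro y hy
    by_cases hyΓ : y ∈ Γ
    · simp [gsum, hG0 y hyΓ]
    have hδ : 0 < infDist y Γ := (hΓ.notMem_iff_infDist_pos ⟨x, hx⟩).1 hyΓ
    have hδr : infDist y Γ ≤ r := (infDist_le_dist_of_mem hx).trans (mem_ball.1 hy).le
    have hw : 0 < wt n d Γ y := Real.rpow_pos_of_pos hδ _
    have hwi : (wt n d Γ y)⁻¹ ≤ r ^ ((n:ℝ) - 1 - d) := by
      unfold wt
      rw [← Real.rpow_neg hδ.le]
      have : -(d + 1 - (n:ℝ)) = (n:ℝ) - 1 - d := by ring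
      rw [this]
      exact Real.rpow_le_rpow hδ.le hδr (by linarith)
    rw [← ENNReal.ofReal_mul ht.le, ← ENNReal.ofReal_add (by positivity) (by positivity)]
    have e : gsum G y = ENNReal.ofReal (∑ i, |G y i|) := by
      unfold gsum
      rw [ENNReal.ofReal_sum_of_nonneg (fun _ _ => abs_nonneg _)]
      simp [Real.enorm_eq_ofReal_abs]
    rw [e]
    apply ENNReal.ofReal_le_ofReal
    have hi : ∀ i ∈ Finset.univ, |G y i| ≤ t * (G y i ^ 2 * wt n d Γ y) + t⁻¹ * r ^ ((n:ℝ) - 1 - d) := by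
      intro i _
      set s := t * wt n d Γ y with hs
      have hs0 : 0 < s := by positivity
      have h1 : |G y i| ≤ s * G y i ^ 2 + s⁻¹ := by
        have : 0 ≤ s⁻¹ * ((s * |G y i| - 1) ^ 2 + s * |G y i|) := by positivity
        have e2 : s⁻¹ * ((s * |G y i| - 1) ^ 2 + s * |G y i|) = s * |G y i|^2 - |G y i| + s⁻¹ := by
          field_simp; ring
        rw [e2, sq_abs] at this
        linarith
      have h2 : s⁻¹ ≤ t⁻¹ * r ^ ((n:ℝ) - 1 - d) := by
        rw [hs, mul_inv]; gcongr
      calc _ ≤ _ := h1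
        _ ≤ s * G y i ^ 2 + t⁻¹ * r ^ ((n:ℝ) - 1 - d) := by gcongr
        _ = _ := by rw [hs]; ring
    refine (Finset.sum_le_sum hi).trans_eq ?_
    rw [Finset.sum_add_distrib, ← Finset.mul_sum, ← Finset.sum_mul]
    simp
    ring
  refine (setLIntegral_mono' measurableSet_ball hp).trans ?_
  rw [lintegral_add_right _ measurable_const, lintegral_const_mul' _ _ (by finiteness)]
  simp

lemma wt_measurable (n : ℕ) (d : ℝ) (Γ : Set (EuclideanSpace ℝ (Fin n))) : Measurable (wt n d Γ) := by
  unfold wt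
  exact (continuous_infDist_pt Γ).measurable.pow_const _

lemma fderiv_eq_sum_pd {n : ℕ} (φ : EuclideanSpace ℝ (Fin n) → ℝ) (y v : EuclideanSpace ℝ (Fin n)) :
    fderiv ℝ φ y v = ∑ i, v i * pd n φ i y := by
  have hv : v = ∑ i, v i • EuclideanSpace.single i (1:ℝ) := by
    ext j
    simp [Pi.single_apply]
  conv_lhs => rw [hv]
  simp [pd, map_sum]

lemma pd_zero_off {n : ℕ} {φ : EuclideanSpace ℝ (Fin n) → ℝ} {i : Fin n} {y : EuclideanSpace ℝ (Fin n)}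
    (hy : y ∉ tsupport φ) : pd n φ i y = 0 := by
  unfold pd
  rw [image_eq_zero_of_notMem_tsupport (fun h => hy (tsupport_fderiv_subset ℝ h))]
  simp

lemma null_of_adr {m : ℕ} {d C₀ : ℝ} (hdn : d < (m : ℝ)) {Γ : Set (EuclideanSpace ℝ (Fin (m+1)))}
    (hADR : ADRegular (m+1) d C₀ Γ) : μH[(m:ℝ)] Γ = 0 := by
  obtain ⟨⟨x0, hx0⟩, h⟩ := hADR
  have hcov : Γ = ⋃ k : ℕ, Γ ∩ ball x0 ((k:ℝ) + 1) := by
    rw [← inter_iUnion]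
    refine (inter_eq_left.2 fun y _ => ?_).symm
    obtain ⟨k, hk⟩ := exists_nat_gt (dist y x0)
    exact mem_iUnion.2 ⟨k, by rw [mem_ball]; linarith⟩
  rw [hcov]
  refine measure_iUnion_null fun k => ?_
  rcases Measure.hausdorffMeasure_zero_or_top hdn (Γ ∩ ball x0 ((k:ℝ)+1)) with h1 | h1
  · exact h1
  · have := (h x0 hx0 ((k:ℝ)+1) (by positivity)).2
    rw [h1] at this
    simp at this

lemma sigma_ball {n : ℕ} {d C₀ : ℝ} {Γ : Set (EuclideanSpace ℝ (Fin n))} (hΓ : IsClosed Γ)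
    (hADR : ADRegular n d C₀ Γ) (A : Set (EuclideanSpace ℝ (Fin n)))
    (y : EuclideanSpace ℝ (Fin n)) {r : ℝ} (hr : 0 < r) :
    ((μH[d] : Measure (EuclideanSpace ℝ (Fin n))).restrict (Γ ∩ A)) (ball y r) ≤
      ENNReal.ofReal (C₀ * 2 ^ d * r ^ d) := by
  rw [Measure.restrict_apply measurableSet_ball]
  by_cases hne : (Γ ∩ ball y r).Nonempty
  · obtain ⟨p, hpΓ, hp⟩ := hne
    have := (hADR.2 p hpΓ (2 * r) (by positivity)).2
    rw [Real.mul_rpow (by norm_num) hr.le, ← mul_assoc] at this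
    refine le_trans (measure_mono ?_) this
    rintro z ⟨hz, hzΓ, -⟩
    refine ⟨hzΓ, ?_⟩
    rw [mem_ball] at *
    have := dist_triangle_right z p y
    linarith
  · rw [not_nonempty_iff_eq_empty] at hne
    have : ball y r ∩ (Γ ∩ A) = ∅ := by
      rw [← subset_empty_iff, ← hne]
      rintro z ⟨hz, hzΓ, -⟩
      exact ⟨hzΓ, hz⟩
    simp [this]

lemma core {m : ℕ} {d C₀ : ℝ} (hdn : d < (m : ℝ)) (hC₀ : 1 ≤ C₀)
    {Γ : Set (EuclideanSpace ℝ (Fin (m+1)))} (hΓ : IsClosed Γ) (hADR : ADRegular (m+1) d C₀ Γ)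
    {u : EuclideanSpace ℝ (Fin (m+1)) → ℝ} {G : EuclideanSpace ℝ (Fin (m+1)) → Fin (m+1) → ℝ}
    (hum : Measurable u) (hu : LocallyIntegrable u) (hGm : ∀ i, Measurable (fun y => G y i))
    (hG0 : ∀ y ∈ Γ, ∀ i, G y i = 0) (hw : HasWeakGradOn (m+1) u G Γᶜ)
    (hQ : ∫⁻ y, ENNReal.ofReal ((∑ i, G y i ^ 2) * wt (m+1) d Γ y) ≠ ⊤) :
    ∀ᵐ x ∂(μH[d] : Measure (EuclideanSpace ℝ (Fin (m+1)))).restrict Γ, ∃ T : ℝ,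
        HasTraceAt (m+1) u T x ∧
          Tendsto (fun r : ℝ => ⨍ y in ball x r, u y) (𝓝[>] (0 : ℝ)) (𝓝 T) := by
  obtain ⟨x0, hx0⟩ := hADR.1
  have hdn' : d < ((m+1 : ℕ) : ℝ) - 1 := by push_cast; linarith
  have hQm : Measurable (fun y => ENNReal.ofReal ((∑ i, G y i ^ 2) * wt (m+1) d Γ y)) :=
    ((Finset.measurable_sum _ fun i _ => (hGm i).pow_const 2).mul (wt_measurable _ _ _)).ennreal_ofReal
  have hgm : Measurable (gsum G) := Finset.measurable_sum _ fun i _ => (hGm i).enorm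
  -- integrability on compacts
  have hgK : ∀ K : Set (EuclideanSpace ℝ (Fin (m+1))), IsCompact K → ∫⁻ y in K, gsum G y ≠ ⊤ := by
    intro K hK
    obtain ⟨r, hr, hKr⟩ := hK.isBounded.subset_ball_lt 0 x0
    refine ne_top_of_le_ne_top ?_ ((lintegral_mono_set hKr).trans
      (gbound hdn' hΓ hG0 hx0 hr (t := 1) one_pos))
    refine ENNReal.add_ne_top.2 ⟨ENNReal.mul_ne_top (by finiteness) ?_, ?_⟩
    · exact ne_top_of_le_ne_top hQ (setLIntegral_le_lintegral _ _)
    · exact ENNReal.mul_ne_top (by finiteness) measure_ball_lt_top.ne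
  have hGi : ∀ i, ∀ K : Set (EuclideanSpace ℝ (Fin (m+1))), IsCompact K →
      IntegrableOn (fun y => G y i) K := by
    intro i K hK
    refine ⟨(hGm i).aestronglyMeasurable, ?_⟩
    refine lt_of_le_of_lt (lintegral_mono fun y => ?_) (hgK K hK).lt_top
    exact Finset.single_le_sum (f := fun i => ‖G y i‖ₑ) (fun _ _ => bot_le) (Finset.mem_univ i)
  -- directional weak derivative
  have hdir : ∀ v : EuclideanSpace ℝ (Fin (m+1)), ∀ φ : EuclideanSpace ℝ (Fin (m+1)) → ℝ,
      ContDiff ℝ (⊤ : ℕ∞) φ → HasCompactSupport φ → tsupport φ ⊆ Γᶜ →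
      ∫ y, u y * fderiv ℝ φ y v = - ∫ y, (∑ i, v i * G y i) * φ y := by
    intro v φ hφ hc hs
    have hcφ := hφ.continuous
    have hcd : Continuous (fderiv ℝ φ) := hφ.continuous_fderiv (by simp)
    have i1 : ∀ i, Integrable (fun y => u y * pd (m+1) φ i y) := by
      intro i
      have hcp : Continuous (pd (m+1) φ i) := by unfold pd; fun_prop
      have hcs : HasCompactSupport (pd (m+1) φ i) :=
        HasCompactSupport.intro hc (fun y hy => pd_zero_off hy)
      have := hu.integrable_smul_left_of_hasCompactSupport hcp hcs
      simpa [mul_comm] using this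
    have i2 : ∀ i, Integrable (fun y => G y i * φ y) := by
      intro i
      obtain ⟨M, hM⟩ := hc.exists_bound_of_continuous hcφ
      have h1 : IntegrableOn (fun y => φ y * G y i) (tsupport φ) := by
        refine (hGi i _ hc).bdd_mul (c := M) (by fun_prop) (Eventually.of_forall hM)
      rw [integrableOn_iff_integrable_of_support_subset] at h1
      · simpa [mul_comm] using h1
      · intro y hy
        by_contra h
        exact hy (by simp [image_eq_zero_of_notMem_tsupport h])
    have hi : ∀ i, ∫ y, u y * pd (m+1) φ i y = - ∫ y, G y i * φ y := by
      intro i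
      have := hw φ hφ hc hs i
      rw [setIntegral_eq_integral_of_forall_compl_eq_zero, setIntegral_eq_integral_of_forall_compl_eq_zero] at this
      · exact this
      · intro y hy
        rw [image_eq_zero_of_notMem_tsupport (fun h => hy (hs h)), mul_zero]
      · intro y hy
        rw [pd_zero_off (fun h => hy (hs h)), mul_zero]
    simp only [fderiv_eq_sum_pd, Finset.mul_sum, Finset.sum_mul]
    rw [integral_finsetSum _ (fun i _ => ?_), integral_finsetSum _ (fun i _ => ?_), ← Finset.sum_neg_distrib]
    · refine Finset.sum_congr rfl fun i _ => ?_
      have e1 : ∀ y, u y * (v i * pd (m+1) φ i y) = v i * (u y * pd (m+1) φ i y) := fun y => by ring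
      have e2 : ∀ y, v i * G y i * φ y = v i * (G y i * φ y) := fun y => by ring
      simp only [e1, e2, integral_const_mul, hi i]
      ring
    · simpa [mul_assoc] using (i2 i).const_mul (v i)
    · simpa [mul_left_comm] using (i1 i).const_mul (v i)
  have hnull := null_of_adr hdn hADR
  have hdiff : ∀ v : EuclideanSpace ℝ (Fin (m+1)), ∀ᵐ y, ‖u (y + v) - u y‖ₑ ≤
      ‖v‖ₑ * ∫⁻ t in Icc (0:ℝ) 1, gsum G (y + t • v) := by
    intro v
    by_cases hv : v = 0
    · simp [hv]
    have hHm : Measurable (fun y => ∑ i, v i * G y i) :=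
      Finset.measurable_sum _ fun i _ => (hGm i).const_mul _
    have hHi : ∀ K, IsCompact K → K ⊆ Γᶜ → IntegrableOn (fun y => ∑ i, v i * G y i) K := fun K hK _ =>
      integrable_finsetSum _ fun i _ => (hGi i K hK).const_mul _
    filter_upwards [ftc_ae hΓ.isOpen_compl v hu hHm hHi (hdir v), null_lines hnull hv] with y h1 h2
    rw [h1 (fun t _ => h2 t)]
    refine (enorm_integral_le_lintegral_enorm _).trans ?_
    rw [← lintegral_const_mul' _ _ (by finiteness)]
    refine lintegral_mono fun t => ?_
    unfold gsum
    rw [Finset.mul_sum]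
    refine (enorm_sum_le _ _).trans (Finset.sum_le_sum fun i _ => ?_)
    rw [enorm_mul]
    gcongr
    rw [enorm_le_iff_norm_le]
    exact PiLp.norm_apply_le v i
  have hpoin := poincare hum hgm hdiff
  -- localize
  have hcov : Γ = ⋃ k : ℕ, Γ ∩ ball x0 ((k:ℝ) + 1) := by
    rw [← inter_iUnion]
    refine (inter_eq_left.2 fun y _ => ?_).symm
    obtain ⟨k, hk⟩ := exists_nat_gt (dist y x0)
    exact mem_iUnion.2 ⟨k, by rw [mem_ball]; linarith⟩
  rw [hcov, ae_restrict_iUnion_iff]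
  intro k
  have hfm : IsFiniteMeasure ((μH[d] : Measure (EuclideanSpace ℝ (Fin (m+1)))).restrict (Γ ∩ ball x0 ((k:ℝ)+1))) := by
    refine ⟨?_⟩
    rw [Measure.restrict_apply_univ]
    exact (hADR.2 x0 hx0 _ (by positivity)).2.trans_lt ENNReal.ofReal_lt_top
  have hdec := energy_decay (σ := (μH[d] : Measure (EuclideanSpace ℝ (Fin (m+1)))).restrict (Γ ∩ ball x0 ((k:ℝ)+1)))
    hQm hQ (C := C₀ * 2 ^ d) (d := d) (by positivity) (fun y r hr => sigma_ball hΓ hADR _ y hr)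
  have hmem : ∀ᵐ x ∂(μH[d] : Measure (EuclideanSpace ℝ (Fin (m+1)))).restrict (Γ ∩ ball x0 ((k:ℝ)+1)), x ∈ Γ := by
    filter_upwards [ae_restrict_mem (hΓ.measurableSet.inter measurableSet_ball)] with x hx using hx.1
  filter_upwards [hdec, hmem] with x hx hxΓ
  obtain ⟨M, hM0, hM⟩ := hx
  set κ : ℝ := volume.real (ball (0 : EuclideanSpace ℝ (Fin (m+1))) 1) with hκdef
  have hκe : volume (ball (0 : EuclideanSpace ℝ (Fin (m+1))) 1) = ENNReal.ofReal κ :=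
    (ofReal_measureReal measure_ball_lt_top.ne).symm
  have hκ : 0 < κ := ENNReal.toReal_pos (measure_ball_pos _ _ one_pos).ne' measure_ball_lt_top.ne
  have hvol : ∀ (z : EuclideanSpace ℝ (Fin (m+1))) (r : ℝ), 0 < r →
      volume (ball z r) = ENNReal.ofReal (r ^ (m+1) * κ) := by
    intro z r hr
    rw [Measure.addHaar_ball_of_pos _ _ hr, hκe, finrank_euclideanSpace_fin,
      ENNReal.ofReal_mul (by positivity)]
  refine trace_of_decay hu x (fun k => (2^(m+2) * (M + (m+1) * κ) / κ) * ((1/2:ℝ) ^ (1/4:ℝ)) ^ k)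
    (fun k => by positivity) ?_ ?_
  · refine (summable_geometric_of_lt_one (by positivity) ?_).mul_left _
    exact Real.rpow_lt_one (by norm_num) (by norm_num) (by norm_num)
  intro k
  refine (hpoin x _).trans ?_
  have e14 : ((1/2:ℝ) ^ (1/4:ℝ)) ^ k = ((1/2:ℝ)^k) ^ (1/4:ℝ) := by
    rw [← Real.rpow_natCast, ← Real.rpow_natCast, ← Real.rpow_mul (by norm_num), ← Real.rpow_mul (by norm_num), mul_comm]
  rw [e14]
  have hMk := hM k
  set r : ℝ := (1/2:ℝ)^k with hrdef
  have hr : 0 < r := by positivity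
  have hg : ∫⁻ y in ball x r, gsum G y ≤ ENNReal.ofReal ((M + (m+1) * κ) * r ^ ((m:ℝ) + 1/4)) := by
    refine (gbound hdn' hΓ hG0 hxΓ hr (t := r ^ ((m:ℝ) + 3/4 - d)) (by positivity)).trans ?_
    refine (add_le_add_left (mul_le_mul_right hMk _) _).trans ?_
    rw [hvol x r hr, ← ENNReal.ofReal_mul (by positivity), ← ENNReal.ofReal_mul (by positivity),
      ← ENNReal.ofReal_add (by positivity) (by positivity)]
    apply ENNReal.ofReal_le_ofReal
    apply le_of_eq
    have a1 : r ^ ((m:ℝ) + 3/4 - d) * (M * r ^ (d - 1/2)) = M * r ^ ((m:ℝ) + 1/4) := by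
      rw [mul_left_comm, ← Real.rpow_add hr]
      congr 2; ring
    have a2 : (r ^ ((m:ℝ) + 3/4 - d))⁻¹ * r ^ (((m+1:ℕ):ℝ) - 1 - d) * r ^ (m+1) = r ^ ((m:ℝ) + 1/4) := by
      rw [← Real.rpow_neg hr.le, ← Real.rpow_natCast r (m+1), ← Real.rpow_add hr, ← Real.rpow_add hr]
      congr 1; push_cast; ring
    rw [a1, add_mul, ← a2]
    push_cast
    ring
  calc volume (ball (0 : EuclideanSpace ℝ (Fin (m+1))) (2*r)) * (ENNReal.ofReal (2*r) * ∫⁻ y in ball x r, gsum G y)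
      ≤ volume (ball (0 : EuclideanSpace ℝ (Fin (m+1))) (2*r)) * (ENNReal.ofReal (2*r) *
        ENNReal.ofReal ((M + (m+1) * κ) * r ^ ((m:ℝ) + 1/4))) := by gcongr
    _ = _ := by
      rw [hvol _ _ (by positivity : 0 < 2 * r), hvol _ _ hr]
      simp only [← ENNReal.ofReal_mul (show 0 ≤ 2 * r by positivity),
        ← ENNReal.ofReal_mul (show 0 ≤ (2 * r)^(m+1) * κ by positivity),
        ← ENNReal.ofReal_mul (show 0 ≤ r^(m+1) * κ by positivity)]
      rw [← ENNReal.ofReal_mul (by positivity)]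
      congr 1
      rw [Real.rpow_add hr, Real.rpow_natCast]
      field_simp
      ring

lemma exists_bad_point {n : ℕ} {f : EuclideanSpace ℝ (Fin n) → ℝ} {U : Set (EuclideanSpace ℝ (Fin n))}
    (hf : ¬ AEMeasurable f (volume.restrict U)) :
    ∃ x ∈ U, ∀ N ∈ 𝓝 x, ¬ AEMeasurable f (volume.restrict N) := by
  by_contra! hcon
  choose! N hN hm using hcon
  obtain ⟨t, htU, htc, hcov⟩ := TopologicalSpace.countable_cover_nhdsWithin
    (s := U) (f := N) (fun x hx => mem_nhdsWithin_of_mem_nhds (hN x hx))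
  apply hf
  have : Countable t := htc.to_subtype
  have h1 : AEMeasurable f (volume.restrict (⋃ x : t, N x)) :=
    (aemeasurable_iUnion_iff (s := fun x : t => N x)).2 fun x => hm x (htU x.2)
  refine h1.mono_measure (Measure.restrict_mono ?_ le_rfl)
  rwa [biUnion_eq_iUnion] at hcov

lemma pd_integrable {n : ℕ} {u φ : EuclideanSpace ℝ (Fin n) → ℝ} (hu : LocallyIntegrable u)
    (hφ : ContDiff ℝ (⊤ : ℕ∞) φ) (hc : HasCompactSupport φ) (i : Fin n) :
    Integrable (fun y => u y * pd n φ i y) := by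
  have h1 : Continuous (fderiv ℝ φ) := hφ.continuous_fderiv (by simp)
  have hcp : Continuous (pd n φ i) := by unfold pd; fun_prop
  have hcs : HasCompactSupport (pd n φ i) :=
    HasCompactSupport.intro hc (fun y hy => pd_zero_off hy)
  have := hu.integrable_smul_left_of_hasCompactSupport hcp hcs
  simpa [mul_comm] using this

lemma nonmeas_zero {n : ℕ} {u : EuclideanSpace ℝ (Fin n) → ℝ} {G : EuclideanSpace ℝ (Fin n) → Fin n → ℝ}
    {U : Set (EuclideanSpace ℝ (Fin n))} (hU : IsOpen U) (hu : LocallyIntegrable u)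
    (hw : HasWeakGradOn n u G U) (i : Fin n)
    (hf : ¬ AEMeasurable (fun y => G y i) (volume.restrict U))
    {φ : EuclideanSpace ℝ (Fin n) → ℝ} (hφ : ContDiff ℝ (⊤ : ℕ∞) φ) (hc : HasCompactSupport φ)
    (hs : tsupport φ ⊆ U) : ∫ y in U, u y * pd n φ i y = 0 := by
  obtain ⟨x, hxU, hx⟩ := exists_bad_point hf
  have key : ∀ ψ : EuclideanSpace ℝ (Fin n) → ℝ, ContDiff ℝ (⊤ : ℕ∞) ψ → HasCompactSupport ψ →
      tsupport ψ ⊆ U → ψ x ≠ 0 → ∫ y in U, u y * pd n ψ i y = 0 := by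
    intro ψ hψ hcψ hsψ hne
    rw [hw ψ hψ hcψ hsψ i, integral_undef, neg_zero]
    intro hint
    have hcont := hψ.continuous
    have hopen : IsOpen {y | ψ y ≠ 0} := isOpen_ne_fun hcont continuous_const
    refine hx ({y | ψ y ≠ 0} ∩ U) ((hopen.inter hU).mem_nhds ⟨hne, hxU⟩) ?_
    have h1 : AEMeasurable (fun y => G y i * ψ y / ψ y) (volume.restrict ({y | ψ y ≠ 0} ∩ U)) :=
      (hint.aestronglyMeasurable.aemeasurable.mono_measure
        (Measure.restrict_mono inter_subset_right le_rfl)).div hcont.measurable.aemeasurable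
    refine h1.congr ?_
    filter_upwards [ae_restrict_mem (hopen.inter hU).measurableSet] with y hy
    exact mul_div_cancel_right₀ _ hy.1
  by_cases h0 : φ x = 0
  · obtain ⟨R, hR, hRU⟩ := Metric.isOpen_iff.1 hU x hxU
    let ψ : ContDiffBump x := ⟨R/4, R/2, by positivity, by linarith⟩
    have hψx : ψ x = 1 := ψ.one_of_mem_closedBall (mem_closedBall_self (by positivity))
    have hψs : tsupport ψ ⊆ U := by
      rw [ψ.tsupport_eq]
      refine (closedBall_subset_ball ?_).trans hRU
      change R/2 < R
      linarith
    have hψc : ContDiff ℝ (⊤ : ℕ∞) ψ := ψ.contDiff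
    have h1 := key ψ hψc ψ.hasCompactSupport hψs (by rw [hψx]; norm_num)
    have h2 := key (fun y => φ y + ψ y) (hφ.add hψc) (hc.add ψ.hasCompactSupport)
      ((tsupport_add φ ψ).trans (union_subset hs hψs)) (by simp [h0, hψx])
    have hpd : ∀ y, pd n (fun y => φ y + ψ y) i y = pd n φ i y + pd n ψ i y := by
      intro y
      unfold pd
      rw [fderiv_fun_add (hφ.differentiable (by simp) y) (hψc.differentiable (by simp) y)]
      rfl
    simp only [hpd, mul_add] at h2
    rw [integral_add (pd_integrable hu hφ hc i).integrableOn
      (pd_integrable hu hψc ψ.hasCompactSupport i).integrableOn, h1, add_zero] at h2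
    exact h2
  · exact key φ hφ hc hs h0

open Classical in
/-- measurable replacement of `G` -/
def measG {n : ℕ} (G : EuclideanSpace ℝ (Fin n) → Fin n → ℝ) (U : Set (EuclideanSpace ℝ (Fin n)))
    (y : EuclideanSpace ℝ (Fin n)) (i : Fin n) : ℝ :=
  if h : AEMeasurable (fun y => G y i) (volume.restrict U) then U.indicator (h.mk _) y else 0

lemma measG_measurable {n : ℕ} (G : EuclideanSpace ℝ (Fin n) → Fin n → ℝ)
    {U : Set (EuclideanSpace ℝ (Fin n))} (hU : IsOpen U) (i : Fin n) :
    Measurable (fun y => measG G U y i) := by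
  by_cases h : AEMeasurable (fun y => G y i) (volume.restrict U)
  · simp only [measG, h, dif_pos]
    exact h.measurable_mk.indicator hU.measurableSet
  · simp only [measG, h, dif_neg, not_false_eq_true]
    exact measurable_const

lemma measG_zero {n : ℕ} (G : EuclideanSpace ℝ (Fin n) → Fin n → ℝ)
    {U : Set (EuclideanSpace ℝ (Fin n))} {y : EuclideanSpace ℝ (Fin n)} (hy : y ∉ U) (i : Fin n) :
    measG G U y i = 0 := by
  unfold measG
  split_ifs with h
  · exact indicator_of_notMem hy _
  · rfl

lemma measG_ae {n : ℕ} (G : EuclideanSpace ℝ (Fin n) → Fin n → ℝ)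
    {U : Set (EuclideanSpace ℝ (Fin n))} (hU : IsOpen U) (i : Fin n)
    (h : AEMeasurable (fun y => G y i) (volume.restrict U)) :
    ∀ᵐ y ∂volume.restrict U, measG G U y i = G y i := by
  filter_upwards [h.ae_eq_mk, ae_restrict_mem hU.measurableSet] with y h1 h2
  simp only [measG, h, dif_pos]
  rw [indicator_of_mem h2, ← h1]

lemma measG_sq {n : ℕ} (G : EuclideanSpace ℝ (Fin n) → Fin n → ℝ)
    {U : Set (EuclideanSpace ℝ (Fin n))} (hU : IsOpen U) (i : Fin n) :
    ∀ᵐ y ∂volume.restrict U, measG G U y i ^ 2 ≤ G y i ^ 2 := by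
  by_cases h : AEMeasurable (fun y => G y i) (volume.restrict U)
  · filter_upwards [measG_ae G hU i h] with y hy
    rw [hy]
  · refine Eventually.of_forall fun y => ?_
    simp only [measG, h, dif_neg, not_false_eq_true]
    rw [zero_pow two_ne_zero]
    exact sq_nonneg _

lemma measG_weak {n : ℕ} {u : EuclideanSpace ℝ (Fin n) → ℝ} {G : EuclideanSpace ℝ (Fin n) → Fin n → ℝ}
    {U : Set (EuclideanSpace ℝ (Fin n))} (hU : IsOpen U) (hu : LocallyIntegrable u)
    (hw : HasWeakGradOn n u G U) : HasWeakGradOn n u (measG G U) U := by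
  intro φ hφ hc hs i
  by_cases h : AEMeasurable (fun y => G y i) (volume.restrict U)
  · rw [hw φ hφ hc hs i]
    congr 1
    refine integral_congr_ae ?_
    filter_upwards [measG_ae G hU i h] with y hy
    rw [hy]
  · rw [nonmeas_zero hU hu hw i h hφ hc hs]
    simp [measG, h]

theorem main_red (n : ℕ) (d C₀ : ℝ) (hd : 0 < d) (hdn : d < (n : ℝ) - 1) (hC₀ : 1 ≤ C₀)
    (Γ : Set (EuclideanSpace ℝ (Fin n))) (hΓ : IsClosed Γ) (hADR : ADRegular n d C₀ Γ) :
    ∀ (u : EuclideanSpace ℝ (Fin n) → ℝ) (G : EuclideanSpace ℝ (Fin n) → Fin n → ℝ),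
      LocallyIntegrable u → HasWeakGradOn n u G Γᶜ →
      (∫⁻ y in Γᶜ, ENNReal.ofReal ((∑ i, G y i ^ 2) * wt n d Γ y)) < ⊤ →
      ∀ᵐ x ∂(μH[d] : Measure (EuclideanSpace ℝ (Fin n))).restrict Γ, ∃ T : ℝ,
        HasTraceAt n u T x ∧
          Tendsto (fun r : ℝ => ⨍ y in ball x r, u y) (𝓝[>] (0 : ℝ)) (𝓝 T) := by
  intro u G hu hw hQ
  obtain _ | m := n
  · norm_num at hdn
    linarith
  have hdm : d < (m:ℝ) := by push_cast at hdn; linarith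
  have hU : IsOpen Γᶜ := hΓ.isOpen_compl
  have hsm := hu.aestronglyMeasurable
  set u' := hsm.mk u with hu'
  have hae : u =ᵐ[volume] u' := hsm.ae_eq_mk
  have hli : LocallyIntegrable u' := by
    intro x
    obtain ⟨s, hs, hi⟩ := hu x
    exact ⟨s, hs, hi.congr (ae_restrict_of_ae hae)⟩
  have hw' : HasWeakGradOn (m+1) u' (measG G Γᶜ) Γᶜ := by
    intro φ hφ hc hs i
    rw [← measG_weak hU hu hw φ hφ hc hs i]
    refine integral_congr_ae (ae_restrict_of_ae ?_)
    filter_upwards [hae] with y hy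
    rw [hy]
  have hQ' : ∫⁻ y, ENNReal.ofReal ((∑ i, measG G Γᶜ y i ^ 2) * wt (m+1) d Γ y) ≠ ⊤ := by
    have hsup : (Function.support fun y => ENNReal.ofReal ((∑ i, measG G Γᶜ y i ^ 2) * wt (m+1) d Γ y)) ⊆ Γᶜ := by
      intro y hy
      by_contra h
      exact hy (by simp [measG_zero G h])
    rw [← setLIntegral_eq_of_support_subset hsup]
    refine ne_top_of_le_ne_top hQ.ne (lintegral_mono_ae ?_)
    filter_upwards [ae_all_iff.2 fun i => measG_sq G hU i] with y hy
    refine ENNReal.ofReal_le_ofReal (mul_le_mul_of_nonneg_right (Finset.sum_le_sum fun i _ => hy i) ?_)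
    unfold wt
    exact Real.rpow_nonneg infDist_nonneg _
  have := core hdm hC₀ hΓ hADR hsm.stronglyMeasurable_mk.measurable hli (measG_measurable G hU)
    (fun y hy i => measG_zero G (by simpa using hy) i) hw' hQ'
  filter_upwards [this] with x hx
  obtain ⟨T, h1, h2⟩ := hx
  refine ⟨T, ?_, ?_⟩
  · unfold HasTraceAt at h1 ⊢
    refine h1.congr fun r => average_congr (ae_restrict_of_ae ?_)
    filter_upwards [hae] with y hy
    rw [hy]
  · refine h2.congr fun r => average_congr (ae_restrict_of_ae ?_)
    filter_upwards [hae] with y hy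
    rw [hy]

/-- Existence of the trace: if `u ∈ L¹_loc(ℝⁿ)` has weak gradient `G` on `Ω`
with `∫_Ω |G|² w < ∞`, then for `σ`-a.e. `x ∈ Γ` there is `T = Tu(x) ∈ ℝ` with
`⨍_{B(x,r)} |u - T| → 0` as `r → 0⁺`; in particular `⨍_{B(x,r)} u → Tu(x)`. -/
theorem statement6 (n : ℕ) (d C₀ : ℝ) (hd : 0 < d) (hdn : d < (n : ℝ) - 1) (hC₀ : 1 ≤ C₀)
    (Γ : Set (EuclideanSpace ℝ (Fin n))) (hΓ : IsClosed Γ) (hADR : ADRegular n d C₀ Γ) :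
    ∀ (u : EuclideanSpace ℝ (Fin n) → ℝ) (G : EuclideanSpace ℝ (Fin n) → Fin n → ℝ),
      LocallyIntegrable u → HasWeakGradOn n u G Γᶜ →
      (∫⁻ y in Γᶜ, ENNReal.ofReal ((∑ i, G y i ^ 2) * wt n d Γ y)) < ⊤ →
      ∀ᵐ x ∂(μH[d] : Measure (EuclideanSpace ℝ (Fin n))).restrict Γ, ∃ T : ℝ,
        HasTraceAt n u T x ∧
          Tendsto (fun r : ℝ => ⨍ y in ball x r, u y) (𝓝[>] (0 : ℝ)) (𝓝 T) := main_red n d C₀ hd hdn hC₀ Γ hΓ hADR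
end
end

section
/- Bilipschitz change of variables adapted to a small Lipschitz graph: let n − 1 > d ≥ 1 be integers and α > 0. There exist τ₀ > 0 and, for each τ ∈ (0, τ₀], a constant C ≥ 1 (both depending only on n, d, α, τ) such that the following holds. Let F : ℝ^d → ℝ^{n−d} be Lipschitz with Lipschitz constant at most τ, let Γ = { (x, F(x)) : x ∈ ℝ^d }, and let D(X) = ( ∫_Γ |X−y|^{−d−α} dH^d(y) )^{−1/α}. Then there exists a bilipschitz homeomorphism ρ : ℝⁿ → ℝⁿ (with bilipschitz constant at most C) such that ρ(ℝ^d) = Γ and such that the measure | D(ρ(x,t)) / |t| − 1 |² dx dt / |t|^{n−d} is a Carleson measure relative to ℝ^d: for every x ∈ ℝ^d and r > 0, ∫_{B((x,0),r) \ ℝ^d} | D(ρ(y,t)) / |t| − 1 |² dy dt / |t|^{n−d} ≤ C r^d. -/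
open MeasureTheory Metric Set Filter ENNReal Topology

noncomputable section

/-- The point `(x,t)` of `ℝⁿ = ℝ^d × ℝ^{n-d}`, with `ℝⁿ` realized as
`EuclideanSpace ℝ (Fin d ⊕ Fin m)`. -/
def emb (d m : ℕ) (x : EuclideanSpace ℝ (Fin d)) (t : EuclideanSpace ℝ (Fin m)) :
    EuclideanSpace ℝ (Fin d ⊕ Fin m) :=
  (EuclideanSpace.equiv (Fin d ⊕ Fin m) ℝ).symm (Sum.elim (fun i => x i) fun j => t j)

/-- `|t|`, the distance of the point `p = (x,t)` to `ℝ^d = ℝ^d × {0}`. -/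
def tn (d m : ℕ) (p : EuclideanSpace ℝ (Fin d ⊕ Fin m)) : ℝ :=
  Real.sqrt (∑ j, p (Sum.inr j) ^ 2)

/-- `|y - x|` where `y` is the `ℝ^d`-part of the point `p = (y,s)` and `x ∈ ℝ^d`. -/
def xdist (d m : ℕ) (p : EuclideanSpace ℝ (Fin d ⊕ Fin m)) (x : EuclideanSpace ℝ (Fin d)) :
    ℝ :=
  Real.sqrt (∑ i, (p (Sum.inl i) - x i) ^ 2)

/-- The components of the gradient `∇u(p)` (in all `n` variables). -/
def gradv (d m : ℕ) (u : EuclideanSpace ℝ (Fin d ⊕ Fin m) → ℝ)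
    (p : EuclideanSpace ℝ (Fin d ⊕ Fin m)) (k : Fin d ⊕ Fin m) : ℝ :=
  fderiv ℝ u p (EuclideanSpace.single k 1)

/-- Degenerate ellipticity with constant `C₁` relative to `ℝ^d ⊆ ℝⁿ` (codimension `m`):
`|t|^{n-d-1} M(x,t)ξ·ζ ≤ C₁|ξ||ζ|` and `|t|^{n-d-1} M(x,t)ξ·ξ ≥ C₁⁻¹|ξ|²`. -/
def Ell (d m : ℕ) (C₁ : ℝ)
    (M : EuclideanSpace ℝ (Fin d ⊕ Fin m) → Matrix (Fin d ⊕ Fin m) (Fin d ⊕ Fin m) ℝ) :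
    Prop :=
  ∀ p, tn d m p ≠ 0 → ∀ ξ ζ : EuclideanSpace ℝ (Fin d ⊕ Fin m),
    tn d m p ^ ((m : ℝ) - 1) * (∑ k, (M p).mulVec (fun l => ξ l) k * ζ k) ≤
        C₁ * ‖ξ‖ * ‖ζ‖ ∧
      C₁⁻¹ * ‖ξ‖ ^ 2 ≤ tn d m p ^ ((m : ℝ) - 1) * (∑ k, (M p).mulVec (fun l => ξ l) k * ξ k)

/-- A nonnegative density `f` on `ℝⁿ \ ℝ^d` defines a Carleson measure relative to `ℝ^d` with
constant `C₂` : `∫_{B(x,r) \ ℝ^d} f ≤ C₂ r^d` for all `x ∈ ℝ^d`, `r > 0`. -/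
def CarlesonRel (d m : ℕ) (f : EuclideanSpace ℝ (Fin d ⊕ Fin m) → ℝ) (C₂ : ℝ) : Prop :=
  ∀ (x : EuclideanSpace ℝ (Fin d)) (r : ℝ), 0 < r →
    (∫⁻ p in ball (emb d m x 0) r ∩ {p | tn d m p ≠ 0}, ENNReal.ofReal (f p)) ≤
      ENNReal.ofReal (C₂ * r ^ d)

/-- `G` is the weak (distributional) gradient of `u` on the set `U ⊆ ℝⁿ`. -/
def HasWeakGradOnS (d m : ℕ) (u : EuclideanSpace ℝ (Fin d ⊕ Fin m) → ℝ)
    (G : EuclideanSpace ℝ (Fin d ⊕ Fin m) → Fin d ⊕ Fin m → ℝ)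
    (U : Set (EuclideanSpace ℝ (Fin d ⊕ Fin m))) : Prop :=
  ∀ φ : EuclideanSpace ℝ (Fin d ⊕ Fin m) → ℝ,
    ContDiff ℝ (⊤ : ℕ∞) φ → HasCompactSupport φ → tsupport φ ⊆ U →
      ∀ k, ∫ y in U, u y * gradv d m φ y k = - ∫ y in U, G y k * φ y

/-- `u` (with weak gradient `G`) is a weak solution of `div A ∇u = 0` on `U`. -/
def IsWeakSolOnS (d m : ℕ)
    (A : EuclideanSpace ℝ (Fin d ⊕ Fin m) → Matrix (Fin d ⊕ Fin m) (Fin d ⊕ Fin m) ℝ)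
    (u : EuclideanSpace ℝ (Fin d ⊕ Fin m) → ℝ)
    (G : EuclideanSpace ℝ (Fin d ⊕ Fin m) → Fin d ⊕ Fin m → ℝ)
    (U : Set (EuclideanSpace ℝ (Fin d ⊕ Fin m))) : Prop :=
  HasWeakGradOnS d m u G U ∧
    ∀ φ : EuclideanSpace ℝ (Fin d ⊕ Fin m) → ℝ,
      ContDiff ℝ (⊤ : ℕ∞) φ → HasCompactSupport φ → tsupport φ ⊆ U →
        ∫ y in U, (∑ k, (A y).mulVec (G y) k * gradv d m φ y k) = 0

/-- The Lipschitz graph `Γ = {(x, F(x)) : x ∈ ℝ^d} ⊆ ℝⁿ`. -/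
def graphG (d m : ℕ) (F : EuclideanSpace ℝ (Fin d) → EuclideanSpace ℝ (Fin m)) :
    Set (EuclideanSpace ℝ (Fin d ⊕ Fin m)) :=
  {p | ∃ x, p = emb d m x (F x)}

/-- The regularized distance `D(X) = (∫_Γ |X - y|^{-d-α} dH^d(y))^{-1/α}`. -/
def Dfun (d m : ℕ) (α : ℝ) (Γ : Set (EuclideanSpace ℝ (Fin d ⊕ Fin m)))
    (X : EuclideanSpace ℝ (Fin d ⊕ Fin m)) : ℝ :=
  (∫ y in Γ, dist X y ^ (-(d : ℝ) - α) ∂μH[(d : ℝ)]) ^ (-α⁻¹)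


theorem rpow_convex_aux {a b p : ℝ} (ha : 0 < a) (hb : 0 < b) (hp : 0 < p) :
    b ^ (-p) - a ^ (-p) ≤ p * b ^ (-p - 1) * (a - b) := by
  have h1 : Real.log (a / b) ≤ a / b - 1 := Real.log_le_sub_one_of_pos (div_pos ha hb)
  have h2 : 1 - p * (a / b - 1) ≤ (a / b) ^ (-p) := by
    rw [Real.rpow_def_of_pos (div_pos ha hb)]
    have := Real.add_one_le_exp (Real.log (a / b) * -p)
    nlinarith
  have h3 : a ^ (-p) = b ^ (-p) * (a / b) ^ (-p) := by
    rw [← Real.mul_rpow hb.le (div_pos ha hb).le]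
    congr 1
    field_simp
  have h4 : b ^ (-p - 1) = b ^ (-p) / b := by
    rw [Real.rpow_sub_one hb.ne']
  have h5 : 0 < b ^ (-p) := Real.rpow_pos_of_pos hb _
  have h6 : p * b ^ (-p - 1) * (a - b) = b ^ (-p) * (p * (a / b - 1)) := by
    rw [h4]; field_simp
  rw [h6, h3]
  nlinarith [mul_le_mul_of_nonneg_left h2 h5.le]

theorem absU_aux {E V : Type*} [NormedAddCommGroup E] [NormedAddCommGroup V] [NormedSpace ℝ V]
    (c L : ℝ) (hc : 0 < c) (hL : 0 < L) (g : E → V → ℝ)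
    (ha : ∀ x u, c * ‖u‖ ≤ g x u ∧ g x u ≤ L * ‖u‖)
    (hb : ∀ x x' u u', g x u - g x' u' ≤ L * (‖x - x'‖ + ‖u - u'‖))
    (hm : ∀ x θ s s', ‖θ‖ = 1 → 0 ≤ s → s ≤ s' → c * (s' - s) ≤ g x (s' • θ) - g x (s • θ)) :
    ∃ U : E → V → V, (∀ x, Function.Bijective (U x)) ∧ (∀ x, U x 0 = 0) ∧
      (∀ x t, g x (U x t) = ‖t‖) ∧
      (∀ x x' t t', ‖U x t - U x' t'‖ ≤
        (3 / c + L / c + 2 * L / c ^ 2) * (‖x - x'‖ + ‖t - t'‖)) ∧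
      (∀ x x' t t', ‖t - t'‖ ≤ (3 * L) * (‖x - x'‖ + ‖U x t - U x' t'‖)) := by
  have hg0 : ∀ x u, 0 ≤ g x u := fun x u => le_trans (by positivity) (ha x u).1
  set Ψ : E → V → V := fun x u => (g x u / ‖u‖) • u with hΨ
  have hk : ∀ x u, g x u / ‖u‖ * ‖u‖ = g x u := by
    intro x u
    by_cases hu : u = 0
    · subst hu
      have := ha x 0
      simp at this
      simp; linarith
    · have : ‖u‖ ≠ 0 := by simpa using hu
      field_simp
  have hkL : ∀ x u, g x u / ‖u‖ ≤ L := by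
    intro x u
    by_cases hu : u = 0
    · subst hu; simp; exact hL.le
    · have : 0 < ‖u‖ := by simpa using hu
      rw [div_le_iff₀ this]; exact (ha x u).2
  have hk0 : ∀ x u, 0 ≤ g x u / ‖u‖ := fun x u => div_nonneg (hg0 x u) (norm_nonneg _)
  have hn : ∀ x u, ‖Ψ x u‖ = g x u := by
    intro x u
    simp only [hΨ]
    rw [norm_smul, Real.norm_of_nonneg (hk0 x u), hk]
  have hup : ∀ x x' u u', ‖Ψ x u - Ψ x' u'‖ ≤ (3 * L) * (‖x - x'‖ + ‖u - u'‖) := by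
    intro x x' u u'
    set k := g x u / ‖u‖ with hkd
    set k' := g x' u' / ‖u'‖ with hkd'
    have e : Ψ x u - Ψ x' u' = k • (u - u') + (k - k') • u' := by
      simp only [hΨ, smul_sub, sub_smul]; rw [← hkd, ← hkd']; abel
    rw [e]
    have h1 : ‖k • (u - u')‖ ≤ L * ‖u - u'‖ := by
      rw [norm_smul, Real.norm_of_nonneg (hk0 x u)]
      exact mul_le_mul_of_nonneg_right (hkL x u) (norm_nonneg _)
    have h2 : ‖(k - k') • u'‖ = |k * (‖u'‖ - ‖u‖) + (g x u - g x' u')| := by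
      rw [norm_smul, Real.norm_eq_abs, ← abs_norm u', ← abs_mul, abs_norm]
      congr 1
      have := hk x u
      have := hk x' u'
      rw [← hkd] at *
      rw [← hkd'] at *
      linarith
    have h3 : |k * (‖u'‖ - ‖u‖)| ≤ L * ‖u - u'‖ := by
      rw [abs_mul, abs_of_nonneg (hk0 x u)]
      refine mul_le_mul (hkL x u) ?_ (abs_nonneg _) hL.le
      rw [norm_sub_rev]; exact abs_norm_sub_norm_le _ _
    have h4 : |g x u - g x' u'| ≤ L * (‖x - x'‖ + ‖u - u'‖) := by
      rw [abs_le]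
      have := hb x x' u u'
      have h := hb x' x u' u
      rw [norm_sub_rev x' x, norm_sub_rev u' u] at h
      constructor <;> linarith
    have h5 := abs_add_le (k * (‖u'‖ - ‖u‖)) (g x u - g x' u')
    have h6 := norm_add_le (k • (u - u')) ((k - k') • u')
    have h7 : 0 ≤ L * ‖x - x'‖ := by positivity
    nlinarith
  have hlow' : ∀ x x' u u', ‖u‖ ≤ ‖u'‖ → ‖u - u'‖ ≤
      (3 / c + L / c + 2 * L / c ^ 2) * (‖x - x'‖ + ‖Ψ x u - Ψ x' u'‖) := by
    intro x x' u u' hle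
    by_cases hu' : u' = 0
    · subst hu'
      have : u = 0 := by simpa using hle
      subst this
      simp; positivity
    have hu'p : 0 < ‖u'‖ := by simpa using hu'
    set θ := ‖u'‖⁻¹ • u' with hθ
    have hθ1 : ‖θ‖ = 1 := by rw [hθ, norm_smul, norm_inv, norm_norm]; field_simp
    have hu'θ : u' = ‖u'‖ • θ := by rw [hθ, smul_smul]; field_simp; simp
    set v := ‖u‖ • θ with hv
    set T := ‖Ψ x u - Ψ x' u'‖ with hT
    have hm1 := hm x' θ ‖u‖ ‖u'‖ hθ1 (norm_nonneg _) hle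
    rw [← hu'θ, ← hv] at hm1
    have hb1 := hb x x' u v
    have hvu : ‖v - u'‖ = ‖u'‖ - ‖u‖ := by
      have e0 : v - u' = (‖u‖ - ‖u'‖) • θ := by rw [sub_smul, ← hu'θ]
      rw [e0, norm_smul, hθ1, Real.norm_eq_abs, abs_sub_comm, abs_of_nonneg (by linarith)]
      ring
    have ht' : Ψ x' u' = g x' u' • θ := by
      simp only [hΨ, hθ, smul_smul]; congr 1
    have hTn : |g x' u' - g x u| ≤ T := by
      rw [← hn, ← hn, hT, norm_sub_rev]; exact abs_norm_sub_norm_le _ _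
    have huv : c * ‖u - v‖ ≤ 2 * T := by
      by_cases hu : u = 0
      · subst hu
        simp [hv]; simp [hT]
      have hup' : 0 < ‖u‖ := by simpa using hu
      have hck : c ≤ g x u / ‖u‖ := by rw [le_div_iff₀ hup']; exact (ha x u).1
      have e1 : ‖(g x u / ‖u‖) • (u - v)‖ = g x u / ‖u‖ * ‖u - v‖ := by
        rw [norm_smul, Real.norm_of_nonneg (hk0 x u)]
      have e2 : (g x u / ‖u‖) • (u - v) = (Ψ x u - Ψ x' u') + (g x' u' - g x u) • θ := by
        rw [smul_sub, hv, smul_smul, hk, ht', sub_smul]; simp only [hΨ]; abel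
      have e3 : ‖(g x u / ‖u‖) • (u - v)‖ ≤ 2 * T := by
        rw [e2]
        refine (norm_add_le _ _).trans ?_
        rw [norm_smul, hθ1, Real.norm_eq_abs]
        linarith
      have := mul_le_mul_of_nonneg_right hck (norm_nonneg (u - v))
      linarith
    have htri : ‖u - u'‖ ≤ ‖u - v‖ + ‖v - u'‖ := norm_sub_le_norm_sub_add_norm_sub _ _ _
    have huv' : ‖u - v‖ ≤ 2 * T / c := by rw [le_div_iff₀ hc]; linarith
    have hTT := (abs_le.1 hTn).2
    have hvu' : ‖v - u'‖ ≤ (T + L * (‖x - x'‖ + 2 * T / c)) / c := by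
      rw [le_div_iff₀ hc, hvu]
      have := mul_le_mul_of_nonneg_left huv' hL.le
      nlinarith
    have hT0 : 0 ≤ T := norm_nonneg _
    have hX0 : 0 ≤ ‖x - x'‖ := norm_nonneg _
    calc ‖u - u'‖ ≤ 2 * T / c + (T + L * (‖x - x'‖ + 2 * T / c)) / c := by linarith
      _ = 3 / c * T + L / c * ‖x - x'‖ + 2 * L / c ^ 2 * T := by field_simp; ring
      _ ≤ _ := by
        have h1 : 0 ≤ 3 / c * ‖x - x'‖ := by positivity
        have h2 : 0 ≤ L / c * T := by positivity
        have h3 : 0 ≤ 2 * L / c ^ 2 * ‖x - x'‖ := by positivity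
        nlinarith
  have hlow : ∀ x x' u u', ‖u - u'‖ ≤
      (3 / c + L / c + 2 * L / c ^ 2) * (‖x - x'‖ + ‖Ψ x u - Ψ x' u'‖) := by
    intro x x' u u'
    rcases le_total ‖u‖ ‖u'‖ with h | h
    · exact hlow' x x' u u' h
    · rw [norm_sub_rev u, norm_sub_rev x, norm_sub_rev (Ψ x u)]; exact hlow' x' x u' u h
  have hbij : ∀ x, Function.Bijective (Ψ x) := by
    intro x
    constructor
    · intro u u' h
      have := hlow x x u u'
      rw [h] at this
      simp at this
      exact sub_eq_zero.1 this
    · intro t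
      by_cases ht : t = 0
      · exact ⟨0, by simp [hΨ, ht]⟩
      have htp : 0 < ‖t‖ := by simpa using ht
      set θ := ‖t‖⁻¹ • t with hθ
      have hθ1 : ‖θ‖ = 1 := by rw [hθ, norm_smul, norm_inv, norm_norm]; field_simp
      have htθ : t = ‖t‖ • θ := by rw [hθ, smul_smul]; field_simp; simp
      have hcont : Continuous (fun s : ℝ => g x (s • θ)) := by
        refine (LipschitzWith.of_le_add_mul L.toNNReal (fun s s' => ?_)).continuous
        have := hb x x (s • θ) (s' • θ)
        rw [← sub_smul, norm_smul, hθ1, sub_self, norm_zero] at this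
        rw [Real.coe_toNNReal _ hL.le, Real.dist_eq, ← Real.norm_eq_abs]
        linarith
      have hiv := intermediate_value_Icc (a := 0) (b := ‖t‖ / c) (by positivity) hcont.continuousOn
      have hmem : ‖t‖ ∈ Icc (g x ((0:ℝ) • θ)) (g x ((‖t‖ / c) • θ)) := by
        constructor
        · have := (ha x ((0:ℝ) • θ)).2
          simp at this
          simp; linarith
        · have := (ha x ((‖t‖ / c) • θ)).1
          rw [norm_smul, hθ1, Real.norm_of_nonneg (by positivity)] at this
          calc ‖t‖ = c * (‖t‖ / c * 1) := by field_simp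
            _ ≤ _ := this
      obtain ⟨s, hs, hs2⟩ := hiv hmem
      simp only at hs2
      have hsp : 0 < s := by
        rcases hs.1.eq_or_lt with h | h
        · rw [← h] at hs2
          have := (ha x ((0:ℝ) • θ)).2
          simp at this hs2
          linarith
        · exact h
      refine ⟨s • θ, ?_⟩
      simp only [hΨ]
      rw [hs2, norm_smul, hθ1, Real.norm_of_nonneg hsp.le, smul_smul]
      have e0 : ‖t‖ / (s * 1) * s = ‖t‖ := by field_simp
      rw [e0, ← htθ]
  choose U hU using fun x => Function.bijective_iff_has_inverse.1 (hbij x)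
  have hΨU : ∀ x t, Ψ x (U x t) = t := fun x t => (hU x).2 t
  refine ⟨U, fun x => ?_, fun x => ?_, fun x t => ?_, fun x x' t t' => ?_, fun x x' t t' => ?_⟩
  · exact Function.bijective_iff_has_inverse.2 ⟨Ψ x, (hU x).2, (hU x).1⟩
  · have := (hU x).1 0
    simpa [hΨ] using this
  · rw [← hn, hΨU]
  · have := hlow x x' (U x t) (U x' t')
    rwa [hΨU, hΨU] at this
  · have := hup x x' (U x t) (U x' t')
    rwa [hΨU, hΨU] at this

theorem W_integrable {E : Type*} [NormedAddCommGroup E] [NormedSpace ℝ E] [FiniteDimensional ℝ E]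
    [MeasurableSpace E] [BorelSpace E] (l : Measure E) [l.IsAddHaarMeasure] {q s : ℝ} (x : E)
    (hq : (Module.finrank ℝ E : ℝ) < q) (hs : 0 < s) :
    Integrable (fun z => (s + ‖z - x‖) ^ (-q)) l ∧
    ∫ z, (s + ‖z - x‖) ^ (-q) ∂l =
      s ^ ((Module.finrank ℝ E : ℝ) - q) * ∫ z, (1 + ‖z‖) ^ (-q) ∂l := by
  have hpt : ∀ z : E, (s + ‖s • z‖) ^ (-q) = s ^ (-q) * (1 + ‖z‖) ^ (-q) := by
    intro z
    rw [norm_smul, Real.norm_of_nonneg hs.le, ← Real.mul_rpow hs.le (by positivity)]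
    congr 1; ring
  have hI : Integrable (fun z : E => (s + ‖z‖) ^ (-q)) l := by
    rw [← integrable_comp_smul_iff l _ hs.ne']
    simp_rw [hpt]
    exact (integrable_one_add_norm hq).const_mul _
  refine ⟨hI.comp_sub_right x, ?_⟩
  rw [integral_sub_right_eq_self (fun z : E => (s + ‖z‖) ^ (-q)) x]
  have h := Measure.integral_comp_smul l (fun z : E => (s + ‖z‖) ^ (-q)) s
  simp_rw [hpt] at h
  rw [integral_const_mul, abs_of_pos (by positivity), smul_eq_mul] at h
  rw [Real.rpow_sub hs, Real.rpow_natCast]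
  rw [Real.rpow_neg hs.le q] at h
  have : s ^ q ≠ 0 := (Real.rpow_pos_of_pos hs _).ne'
  field_simp at h ⊢
  linarith

theorem W_pos {E : Type*} [NormedAddCommGroup E] [NormedSpace ℝ E] [FiniteDimensional ℝ E]
    [MeasurableSpace E] [BorelSpace E] (l : Measure E) [l.IsAddHaarMeasure] {q : ℝ}
    (hq : (Module.finrank ℝ E : ℝ) < q) : 0 < ∫ z, (1 + ‖z‖) ^ (-q) ∂l := by
  refine integral_pos_of_integrable_nonneg_nonzero (x := 0) ?_ (integrable_one_add_norm hq) ?_ ?_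
  · refine Continuous.rpow_const (by fun_prop) (fun z => Or.inl (by positivity))
  · intro z; positivity
  · simp

theorem J_bounds {E : Type*} [NormedAddCommGroup E] [NormedSpace ℝ E] [FiniteDimensional ℝ E]
    [MeasurableSpace E] [BorelSpace E] (l : Measure E) [l.IsAddHaarMeasure] (M : NNReal) {q : ℝ}
    (hq : (Module.finrank ℝ E : ℝ) < q) :
    ∃ c C : ℝ, 0 < c ∧ 0 < C ∧ ∀ (ν : Measure E), l ≤ ν → ν ≤ M • l → ∀ (x : E) (s : ℝ), 0 < s →
      ∀ b : E → ℝ, Continuous b → (∀ z, b z ≤ 2 * (s + ‖z - x‖)) →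
      (∀ z, s + ‖z - x‖ ≤ 3 * b z) →
      Integrable (fun z => b z ^ (-q)) ν ∧
      c * s ^ ((Module.finrank ℝ E : ℝ) - q) ≤ ∫ z, b z ^ (-q) ∂ν ∧
      ∫ z, b z ^ (-q) ∂ν ≤ C * s ^ ((Module.finrank ℝ E : ℝ) - q) := by
  have hW := W_pos l hq
  have hq0 : 0 < q := lt_of_le_of_lt (by positivity) hq
  set W := ∫ z, (1 + ‖z‖) ^ (-q) ∂l with hWd
  refine ⟨2 ^ (-q) * W, 3 ^ q * ((M : ℝ) + 1) * W, by positivity, by positivity, ?_⟩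
  intro ν h1 h2 x s hs b hbc hb1 hb2
  obtain ⟨hi, he⟩ := W_integrable l x hq hs
  rw [← hWd] at he
  have hpos : ∀ z, 0 < s + ‖z - x‖ := fun z => by positivity
  have hb0 : ∀ z, 0 < b z := fun z => by linarith [hpos z, hb2 z]
  have hlow : ∀ z, 2 ^ (-q) * (s + ‖z - x‖) ^ (-q) ≤ b z ^ (-q) := by
    intro z
    rw [← Real.mul_rpow (by norm_num) (hpos z).le]
    exact Real.rpow_le_rpow_of_nonpos (hb0 z) (hb1 z) (by linarith)
  have hupp : ∀ z, b z ^ (-q) ≤ 3 ^ q * (s + ‖z - x‖) ^ (-q) := by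
    intro z
    have : (3 * b z) ^ (-q) ≤ (s + ‖z - x‖) ^ (-q) :=
      Real.rpow_le_rpow_of_nonpos (hpos z) (hb2 z) (by linarith)
    rw [Real.mul_rpow (by norm_num) (hb0 z).le, Real.rpow_neg (by norm_num)] at this
    have h3 : (0:ℝ) < 3 ^ q := by positivity
    rwa [inv_mul_le_iff₀ h3] at this
  have hiM : Integrable (fun z => (s + ‖z - x‖) ^ (-q)) (M • l) := hi.smul_measure_nnreal
  have hiν : Integrable (fun z => (s + ‖z - x‖) ^ (-q)) ν := hiM.mono_measure h2
  have hbi : Integrable (fun z => b z ^ (-q)) ν := by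
    refine (hiν.const_mul (3 ^ q)).mono' ?_ (ae_of_all _ fun z => ?_)
    · exact (Continuous.rpow_const hbc (fun z => Or.inl (hb0 z).ne')).aestronglyMeasurable
    · rw [Real.norm_of_nonneg (Real.rpow_nonneg (hb0 z).le _)]; exact hupp z
  have hnn : ∀ z, 0 ≤ (s + ‖z - x‖) ^ (-q) := fun z => Real.rpow_nonneg (hpos z).le _
  refine ⟨hbi, ?_, ?_⟩
  · calc _ = 2 ^ (-q) * ∫ z, (s + ‖z - x‖) ^ (-q) ∂l := by rw [he]; ring
      _ ≤ 2 ^ (-q) * ∫ z, (s + ‖z - x‖) ^ (-q) ∂ν := by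
        refine mul_le_mul_of_nonneg_left ?_ (by positivity)
        exact integral_mono_measure h1 (ae_of_all _ hnn) hiν
      _ = ∫ z, 2 ^ (-q) * (s + ‖z - x‖) ^ (-q) ∂ν := by rw [integral_const_mul]
      _ ≤ _ := integral_mono (hiν.const_mul _) hbi hlow
  · calc _ ≤ ∫ z, 3 ^ q * (s + ‖z - x‖) ^ (-q) ∂ν := integral_mono hbi (hiν.const_mul _) hupp
      _ = 3 ^ q * ∫ z, (s + ‖z - x‖) ^ (-q) ∂ν := by rw [integral_const_mul]
      _ ≤ 3 ^ q * ∫ z, (s + ‖z - x‖) ^ (-q) ∂(M • l) := by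
        refine mul_le_mul_of_nonneg_left ?_ (by positivity)
        exact integral_mono_measure h2 (ae_of_all _ hnn) hiM
      _ = 3 ^ q * (M * ∫ z, (s + ‖z - x‖) ^ (-q) ∂l) := by
        rw [integral_smul_nnreal_measure]; rfl
      _ ≤ _ := by
        rw [he]
        have : 0 ≤ 3 ^ q * (s ^ ((Module.finrank ℝ E : ℝ) - q) * W) := by positivity
        nlinarith

noncomputable def bb {E V : Type*} [NormedAddCommGroup E] [NormedAddCommGroup V]
    (F : E → V) (x : E) (u : V) (z : E) : ℝ := √(‖x - z‖ ^ 2 + ‖F x + u - F z‖ ^ 2)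

theorem sqrt_aux {a b a' b' A B : ℝ} (ha : 0 ≤ a) (hb : 0 ≤ b) (ha' : 0 ≤ a') (hb' : 0 ≤ b')
    (hA : 0 ≤ A) (hB : 0 ≤ B)
    (h1 : a ≤ a' + A) (h2 : b ≤ b' + B) : √(a ^ 2 + b ^ 2) ≤ √(a' ^ 2 + b' ^ 2) + (A + B) := by
  have hr : 0 ≤ √(a' ^ 2 + b' ^ 2) := Real.sqrt_nonneg _
  have hr2 : √(a' ^ 2 + b' ^ 2) ^ 2 = a' ^ 2 + b' ^ 2 := Real.sq_sqrt (by positivity)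
  set r := √(a' ^ 2 + b' ^ 2)
  have hra : a' ≤ r := by nlinarith
  have hrb : b' ≤ r := by nlinarith
  apply Real.sqrt_le_iff.2 ⟨by positivity, ?_⟩
  have e1 : a ^ 2 ≤ (a' + A) ^ 2 := by gcongr
  have e2 : b ^ 2 ≤ (b' + B) ^ 2 := by gcongr
  nlinarith [mul_le_mul_of_nonneg_right hra hA, mul_le_mul_of_nonneg_right hrb hB, mul_nonneg hA hB]

section
variable {E V : Type*} [NormedAddCommGroup E] [NormedAddCommGroup V] {F : E → V} {τ : ℝ}

theorem bb_lip (hτ : τ ≤ 1) (hF : ∀ x z, ‖F x - F z‖ ≤ τ * ‖x - z‖) (x x' : E) (u u' : V) (z : E) :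
    bb F x u z ≤ bb F x' u' z + 2 * (‖x - x'‖ + ‖u - u'‖) := by
  have h1 : ‖x - z‖ ≤ ‖x' - z‖ + ‖x - x'‖ := by
    have := norm_sub_le_norm_sub_add_norm_sub x x' z
    linarith
  have h2 : ‖F x + u - F z‖ ≤ ‖F x' + u' - F z‖ + (‖x - x'‖ + ‖u - u'‖) := by
    have e : F x + u - F z = (F x' + u' - F z) + ((F x - F x') + (u - u')) := by abel
    rw [e]
    refine (norm_add_le _ _).trans (add_le_add le_rfl ((norm_add_le _ _).trans ?_))
    have := hF x x'
    nlinarith [norm_nonneg (x - x')]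
  have := sqrt_aux (norm_nonneg _) (norm_nonneg _) (norm_nonneg _) (norm_nonneg _) (norm_nonneg _)
    (by positivity) h1 h2
  unfold bb
  linarith [norm_nonneg (u - u')]

theorem bb_fst (x : E) (u : V) (z : E) : ‖z - x‖ ≤ bb F x u z := by
  rw [norm_sub_rev]; unfold bb; apply Real.le_sqrt_of_sq_le; nlinarith [sq_nonneg ‖F x + u - F z‖]

theorem bb_le (hτ : τ ≤ 1) (hF : ∀ x z, ‖F x - F z‖ ≤ τ * ‖x - z‖) (x : E) (u : V) (z : E) :
    bb F x u z ≤ 2 * (‖u‖ + ‖z - x‖) := by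
  have := bb_lip hτ hF x z u 0 z
  have h0 : bb F z 0 z = 0 := by simp [bb]
  rw [h0, sub_zero, norm_sub_rev] at this
  linarith

theorem bb_ge (hτ : τ ≤ 1) (hF : ∀ x z, ‖F x - F z‖ ≤ τ * ‖x - z‖) (x : E) (u : V) (z : E) :
    ‖u‖ + ‖z - x‖ ≤ 3 * bb F x u z := by
  have h1 : ‖z - x‖ ≤ bb F x u z := bb_fst x u z
  have h2 : ‖F x + u - F z‖ ≤ bb F x u z := by
    unfold bb; apply Real.le_sqrt_of_sq_le; nlinarith [sq_nonneg ‖x - z‖]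
  have h3 : ‖u‖ ≤ ‖F x + u - F z‖ + ‖F x - F z‖ := by
    have e : u = (F x + u - F z) - (F x - F z) := by abel
    nth_rw 1 [e]; exact norm_sub_le _ _
  have := hF x z
  rw [norm_sub_rev x z] at this
  nlinarith [norm_nonneg (z - x)]

theorem bb_cont (hF : ∀ x z, ‖F x - F z‖ ≤ τ * ‖x - z‖) (x : E) (u : V) :
    Continuous (bb F x u) := by
  have : Continuous F := by
    have h : LipschitzWith τ.toNNReal F := by
      apply LipschitzWith.of_dist_le_mul
      intro a b
      rw [dist_eq_norm, dist_eq_norm]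
      exact (hF a b).trans (mul_le_mul_of_nonneg_right (Real.le_coe_toNNReal τ) (norm_nonneg _))
    exact h.continuous
  unfold bb
  fun_prop
end

theorem bb_ray {E V : Type*} [NormedAddCommGroup E] [NormedAddCommGroup V] [InnerProductSpace ℝ V]
    {F : E → V} {τ : ℝ} (hF : ∀ x z, ‖F x - F z‖ ≤ τ * ‖x - z‖) (x : E) (θ : V) (hθ : ‖θ‖ = 1)
    {s s' : ℝ} (hs : 0 ≤ s) (hss : s ≤ s') (z : E) :
    (s' - s) * (s' - 2 * τ * ‖z - x‖) ≤ bb F x (s' • θ) z ^ 2 - bb F x (s • θ) z ^ 2 := by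
  unfold bb
  rw [Real.sq_sqrt (by positivity), Real.sq_sqrt (by positivity)]
  have e : ∀ r : ℝ, ‖F x + r • θ - F z‖ ^ 2 =
      ‖F x - F z‖ ^ 2 + 2 * r * inner ℝ (F x - F z) θ + r ^ 2 := by
    intro r
    have : F x + r • θ - F z = (F x - F z) + r • θ := by abel
    rw [this, norm_add_sq_real, inner_smul_right, norm_smul, hθ, Real.norm_eq_abs, mul_one, sq_abs]
    ring
  rw [e, e]
  have h1 := abs_real_inner_le_norm (F x - F z) θ
  rw [hθ, mul_one] at h1
  have h2 := hF x z
  rw [norm_sub_rev x z] at h2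
  have h3 := (abs_le.1 h1).1
  have h4 : -(τ * ‖z - x‖) ≤ inner ℝ (F x - F z) θ := by linarith
  nlinarith [mul_le_mul_of_nonneg_left h4 (sub_nonneg.2 hss), mul_nonneg hs (sub_nonneg.2 hss)]

theorem sq_rpow_aux {a p : ℝ} (ha : 0 < a) : (a ^ 2) ^ (-(p / 2)) = a ^ (-p) := by
  rw [← Real.rpow_natCast, ← Real.rpow_mul ha.le]; congr 1; push_cast; ring

theorem ray_pt {B B' p h : ℝ} (hB : 0 < B) (hB' : 0 < B') (hp : 0 < p) (hh : h ≤ B' ^ 2 - B ^ 2) :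
    p / 2 * B' ^ (-(p + 2)) * h ≤ B ^ (-p) - B' ^ (-p) := by
  have h1 := rpow_convex_aux (a := B ^ 2) (b := B' ^ 2) (p := p / 2) (by positivity) (by positivity)
    (by positivity)
  rw [sq_rpow_aux hB, sq_rpow_aux hB'] at h1
  have e : (B' ^ 2) ^ (-(p / 2) - 1) = B' ^ (-(p + 2)) := by
    rw [← sq_rpow_aux hB']; congr 1; ring
  rw [e] at h1
  have : 0 < p / 2 * B' ^ (-(p + 2)) := by positivity
  nlinarith [mul_le_mul_of_nonneg_left hh this.le]

theorem scal_inv {α K : ℝ} (hα : 0 < α) (hK : 0 < K) : (K ^ (-α⁻¹)) ^ (-α) = K := by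
  rw [← Real.rpow_mul hK.le]
  have : -α⁻¹ * -α = 1 := by field_simp
  rw [this, Real.rpow_one]

theorem scal_inv2 {α s c : ℝ} (hα : 0 < α) (hs : 0 < s) (hc : 0 < c) :
    (c * s ^ (-α)) ^ (-α⁻¹) = c ^ (-α⁻¹) * s := by
  rw [Real.mul_rpow hc.le (by positivity), ← Real.rpow_mul hs.le]
  have : -α * -α⁻¹ = 1 := by field_simp
  rw [this, Real.rpow_one]

theorem scal_bd1 {α s c K : ℝ} (hα : 0 < α) (hs : 0 < s) (hc : 0 < c) (h : c * s ^ (-α) ≤ K) :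
    K ^ (-α⁻¹) ≤ c ^ (-α⁻¹) * s := by
  rw [← scal_inv2 hα hs hc]
  exact Real.rpow_le_rpow_of_nonpos (by positivity) h (by simp [hα.le])

theorem scal_bd2 {α s c K : ℝ} (hα : 0 < α) (hs : 0 < s) (hc : 0 < c) (hK : 0 < K)
    (h : K ≤ c * s ^ (-α)) : c ^ (-α⁻¹) * s ≤ K ^ (-α⁻¹) := by
  rw [← scal_inv2 hα hs hc]
  exact Real.rpow_le_rpow_of_nonpos hK h (by simp [hα.le])

theorem scal_lip {α A c0 : ℝ} (hα : 0 < α) (hA : 0 < A) (hc : 0 < c0) :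
    ∃ L : ℝ, 0 < L ∧ ∀ s s' δ K K' : ℝ, 0 < s → 0 < s' → s ≤ s' + δ → 0 ≤ δ → 0 < K' →
      c0 * s ^ (-α) ≤ K → K' - K ≤ A * δ * s' ^ (-α - 1) →
      K ^ (-α⁻¹) - K' ^ (-α⁻¹) ≤ L * δ := by
  set l := c0 ^ (-α⁻¹) with hl
  have hl0 : 0 < l := by positivity
  refine ⟨2 * l + A / α * (2 * l) ^ (α + 1), by positivity, ?_⟩
  intro s s' δ K K' hs hs' hsd hδ hK' hK hKK
  have hKp : 0 < K := lt_of_lt_of_le (by positivity) hK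
  have hg : K ^ (-α⁻¹) ≤ l * s := scal_bd1 hα hs hc hK
  have hgp : 0 < K ^ (-α⁻¹) := by positivity
  have hgp' : 0 < K' ^ (-α⁻¹) := by positivity
  have hcv := rpow_convex_aux hgp' hgp hα
  rw [scal_inv hα hKp, scal_inv hα hK'] at hcv
  set g := K ^ (-α⁻¹)
  set g' := K' ^ (-α⁻¹)
  have hP : 0 ≤ A / α * (2 * l) ^ (α + 1) * δ := by positivity
  have hP2 : 0 ≤ 2 * l * δ := by positivity
  rcases le_total g g' with h | h
  · nlinarith
  rcases le_total s (2 * s') with h2 | h2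
  · have hg2 : g ≤ 2 * l * s' := by nlinarith
    have hg3 : (2 * l) ^ (-α - 1) * s' ^ (-α - 1) ≤ g ^ (-α - 1) := by
      rw [← Real.mul_rpow (by positivity) hs'.le]
      exact Real.rpow_le_rpow_of_nonpos hgp hg2 (by linarith)
    have h4 : α * ((2 * l) ^ (-α - 1) * s' ^ (-α - 1)) * (g - g') ≤ A * δ * s' ^ (-α - 1) := by
      have := mul_le_mul_of_nonneg_left hg3 (mul_nonneg hα.le (sub_nonneg.2 h))
      nlinarith
    have hs1 : 0 < s' ^ (-α - 1) := by positivity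
    have h5 : α * (2 * l) ^ (-α - 1) * (g - g') ≤ A * δ := by
      refine le_of_mul_le_mul_right ?_ hs1
      linarith
    have h6 : (2 * l) ^ (-α - 1) = ((2 * l) ^ (α + 1))⁻¹ := by
      rw [← Real.rpow_neg (by positivity)]; congr 1; ring
    rw [h6] at h5
    have h7 : 0 < (2 * l) ^ (α + 1) := by positivity
    have h8 : g - g' ≤ A / α * (2 * l) ^ (α + 1) * δ := by
      field_simp at h5 ⊢
      linarith
    linarith
  · have : s ≤ 2 * δ := by linarith
    nlinarith

theorem scal_mono {α κ C0 : ℝ} (hα : 0 < α) (hκ : 0 < κ) (hC : 0 < C0) :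
    ∃ c : ℝ, 0 < c ∧ ∀ s s' K K' : ℝ, 0 < s → s ≤ s' → 0 < K' →
      K' ≤ C0 * s' ^ (-α) → κ * (s' - s) * s' ^ (-α - 1) ≤ K - K' →
      c * (s' - s) ≤ K' ^ (-α⁻¹) - K ^ (-α⁻¹) := by
  set ε := κ / C0 with hε
  have hε0 : 0 < ε := by positivity
  set n := α⁻¹ with hn
  have hn0 : 0 < n := by positivity
  refine ⟨n * ε * (1 + ε) ^ (-n - 1) * C0 ^ (-n), by positivity, ?_⟩
  intro s s' K K' hs hss hK' hKC hKK
  have hs' : 0 < s' := by linarith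
  set h := (s' - s) / s' with hh
  have hh0 : 0 ≤ h := div_nonneg (by linarith) hs'.le
  have hh1 : h ≤ 1 := by rw [hh, div_le_one hs']; linarith
  have hhs : h * s' = s' - s := by rw [hh]; field_simp
  have h1 : K' * (1 + ε * h) ≤ K := by
    have e : κ * (s' - s) * s' ^ (-α - 1) = κ * h * s' ^ (-α) := by
      rw [Real.rpow_sub_one hs'.ne', hh]; field_simp
    rw [e] at hKK
    have e2 : K' * ε * h ≤ κ * h * s' ^ (-α) := by
      have := mul_le_mul_of_nonneg_right hKC (mul_nonneg hε0.le hh0)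
      have e3 : C0 * s' ^ (-α) * (ε * h) = κ * h * s' ^ (-α) := by rw [hε]; field_simp
      linarith
    linarith
  have hpos : 0 < 1 + ε * h := by positivity
  have h2 : K ^ (-n) ≤ K' ^ (-n) * (1 + ε * h) ^ (-n) := by
    rw [← Real.mul_rpow hK'.le hpos.le]
    exact Real.rpow_le_rpow_of_nonpos (by positivity) h1 (by linarith)
  have h3 := rpow_convex_aux (a := 1) one_pos hpos hn0
  rw [Real.one_rpow] at h3
  have h4 : (1 + ε) ^ (-n - 1) ≤ (1 + ε * h) ^ (-n - 1) :=
    Real.rpow_le_rpow_of_nonpos hpos (by nlinarith) (by linarith)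
  have h5 : n * ε * h * (1 + ε) ^ (-n - 1) ≤ 1 - (1 + ε * h) ^ (-n) := by
    have := mul_le_mul_of_nonneg_left h4 (by positivity : 0 ≤ n * ε * h)
    nlinarith
  have h6 : C0 ^ (-n) * s' ≤ K' ^ (-n) := scal_bd2 hα hs' hC hK' hKC
  have h7 : 0 < K' ^ (-n) := by positivity
  calc _ = n * ε * h * (1 + ε) ^ (-n - 1) * (C0 ^ (-n) * s') := by rw [← hhs]; ring
    _ ≤ n * ε * h * (1 + ε) ^ (-n - 1) * K' ^ (-n) := by gcongr
    _ ≤ (1 - (1 + ε * h) ^ (-n)) * K' ^ (-n) := by gcongr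
    _ ≤ _ := by linarith

open Classical in
theorem main_g {E V : Type*} [NormedAddCommGroup E] [NormedSpace ℝ E] [FiniteDimensional ℝ E]
    [MeasurableSpace E] [BorelSpace E] [NormedAddCommGroup V] [InnerProductSpace ℝ V]
    (l : Measure E) [l.IsAddHaarMeasure] (M : NNReal) {α : ℝ} (hα : 0 < α) :
    ∃ τ₀ c L : ℝ, 0 < τ₀ ∧ τ₀ ≤ 1 ∧ 0 < c ∧ 0 < L ∧ ∀ τ : ℝ, τ ≤ τ₀ → ∀ F : E → V,
      (∀ x z, ‖F x - F z‖ ≤ τ * ‖x - z‖) → ∀ ν : Measure E, l ≤ ν → ν ≤ M • l →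
      ∀ g : E → V → ℝ, (∀ x u, g x u = if u = 0 then 0 else
        (∫ z, bb F x u z ^ (-((Module.finrank ℝ E : ℝ) + α)) ∂ν) ^ (-α⁻¹)) →
      (∀ x u, c * ‖u‖ ≤ g x u ∧ g x u ≤ L * ‖u‖) ∧
      (∀ x x' u u', g x u - g x' u' ≤ L * (‖x - x'‖ + ‖u - u'‖)) ∧
      (∀ x θ s s', ‖θ‖ = 1 → 0 ≤ s → s ≤ s' →
        c * (s' - s) ≤ g x (s' • θ) - g x (s • θ)) := by
  set D : ℝ := (Module.finrank ℝ E : ℝ) with hD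
  have hD0 : 0 ≤ D := by positivity
  obtain ⟨c0, C0, hc0, hC0, H0⟩ := J_bounds l M (q := D + α) (by linarith)
  obtain ⟨c1, C1, hc1, hC1, H1⟩ := J_bounds l M (q := D + α + 1) (by linarith)
  obtain ⟨c2, C2, hc2, hC2, H2⟩ := J_bounds l M (q := D + α + 2) (by linarith)
  rw [← hD] at H0 H1 H2
  set p := D + α with hp
  have hp0 : 0 < p := by positivity
  obtain ⟨L1, hL1, SL⟩ := scal_lip (A := 2 * p * C1) hα (by positivity) hc0
  obtain ⟨k1, hk1, SM⟩ := scal_mono (κ := p / 2 * (c2 / 2)) hα (by positivity) hC0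
  have hl0 : 0 < c0 ^ (-α⁻¹) := by positivity
  have hu0 : 0 < C0 ^ (-α⁻¹) := by positivity
  refine ⟨min 1 (c2 / (4 * C1)), min k1 (C0 ^ (-α⁻¹)), L1 + c0 ^ (-α⁻¹), by positivity,
    min_le_left _ _, by positivity, by positivity, ?_⟩
  intro τ hτ F hF ν hν1 hν2 g hg
  have hτ1 : τ ≤ 1 := hτ.trans (min_le_left _ _)
  have hτ2 : τ * (4 * C1) ≤ c2 := by
    have := hτ.trans (min_le_right _ _)
    rwa [le_div_iff₀ (by positivity)] at this
  have e0 : D - p = -α := by rw [hp]; ring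
  have e1 : D - (p + 1) = -α - 1 := by rw [hp]; ring
  have e2 : D - (p + 2) = -α - 2 := by rw [hp]; ring
  have J0 := fun x u (hu : 0 < ‖u‖) => H0 ν hν1 hν2 x ‖u‖ hu (bb F x u) (bb_cont hF x u)
    (bb_le hτ1 hF x u) (bb_ge hτ1 hF x u)
  have J1 := fun x u (hu : 0 < ‖u‖) => H1 ν hν1 hν2 x ‖u‖ hu (bb F x u) (bb_cont hF x u)
    (bb_le hτ1 hF x u) (bb_ge hτ1 hF x u)
  have J2 := fun x u (hu : 0 < ‖u‖) => H2 ν hν1 hν2 x ‖u‖ hu (bb F x u) (bb_cont hF x u)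
    (bb_le hτ1 hF x u) (bb_ge hτ1 hF x u)
  rw [e0] at J0
  rw [e1] at J1
  rw [e2] at J2
  have hbp : ∀ x u z, 0 < ‖u‖ → 0 < bb F x u z := by
    intro x u z hu
    have := bb_ge hτ1 hF x u z
    linarith [norm_nonneg (z - x)]
  set K : E → V → ℝ := fun x u => ∫ z, bb F x u z ^ (-p) ∂ν with hK
  have hKpos : ∀ x u, 0 < ‖u‖ → 0 < K x u := fun x u hu =>
    lt_of_lt_of_le (by positivity) (J0 x u hu).2.1
  have hgK : ∀ x u, 0 < ‖u‖ → g x u = K x u ^ (-α⁻¹) := by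
    intro x u hu
    rw [hg, if_neg (by simpa using hu)]
  have hg0 : ∀ x, g x 0 = 0 := fun x => by rw [hg, if_pos rfl]
  have hA : ∀ x u, min k1 (C0 ^ (-α⁻¹)) * ‖u‖ ≤ g x u ∧ g x u ≤ c0 ^ (-α⁻¹) * ‖u‖ := by
    intro x u
    by_cases hu : u = 0
    · subst hu; simp [hg0]
    have hup : 0 < ‖u‖ := by simpa using hu
    rw [hgK x u hup]
    refine ⟨?_, scal_bd1 hα hup hc0 (J0 x u hup).2.1⟩
    refine le_trans ?_ (scal_bd2 hα hup hC0 (hKpos x u hup) (J0 x u hup).2.2)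
    gcongr
    exact min_le_right _ _
  refine ⟨fun x u => ⟨(hA x u).1, (hA x u).2.trans ?_⟩, ?_, ?_⟩
  · gcongr; linarith
  · intro x x' u u'
    set δ := ‖x - x'‖ + ‖u - u'‖ with hδ
    have hδ0 : 0 ≤ δ := by positivity
    have hP1 : 0 ≤ L1 * δ := by positivity
    have hP2 : 0 ≤ c0 ^ (-α⁻¹) * δ := by positivity
    by_cases hu : u = 0
    · subst hu
      have := le_trans (by positivity) (hA x' u').1
      rw [hg0]; linarith
    by_cases hu' : u' = 0
    · subst hu'
      rw [hg0, sub_zero]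
      refine (hA x u).2.trans ?_
      have : ‖u‖ ≤ δ := by simp [hδ]
      nlinarith
    have hup : 0 < ‖u‖ := by simpa using hu
    have hup' : 0 < ‖u'‖ := by simpa using hu'
    rw [hgK x u hup, hgK x' u' hup']
    have hsd : ‖u‖ ≤ ‖u'‖ + δ := by
      have := norm_sub_norm_le u u'
      have := norm_nonneg (x - x')
      linarith
    have hmain : K x' u' - K x u ≤ 2 * p * C1 * δ * ‖u'‖ ^ (-α - 1) := by
      simp only [hK]
      rw [← integral_sub (J0 x' u' hup').1 (J0 x u hup).1]
      calc _ ≤ ∫ z, p * (2 * δ) * bb F x' u' z ^ (-(p + 1)) ∂ν := by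
            refine integral_mono ((J0 x' u' hup').1.sub (J0 x u hup).1)
              ((J1 x' u' hup').1.const_mul _) (fun z => ?_)
            have h1 := rpow_convex_aux (hbp x u z hup) (hbp x' u' z hup') hp0
            have h2 : bb F x u z - bb F x' u' z ≤ 2 * δ := by
              linarith [bb_lip hτ1 hF x x' u u' z]
            have h3 : 0 < p * bb F x' u' z ^ (-p - 1) :=
              mul_pos hp0 (Real.rpow_pos_of_pos (hbp x' u' z hup') _)
            have h4 := mul_le_mul_of_nonneg_left h2 h3.le
            have e : -(p + 1) = -p - 1 := by ring
            rw [e]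
            simp only
            linarith
        _ = p * (2 * δ) * ∫ z, bb F x' u' z ^ (-(p + 1)) ∂ν := integral_const_mul _ _
        _ ≤ p * (2 * δ) * (C1 * ‖u'‖ ^ (-α - 1)) := by
            gcongr
            exact (J1 x' u' hup').2.2
        _ = _ := by ring
    have := SL ‖u‖ ‖u'‖ δ (K x u) (K x' u') hup hup' hsd hδ0 (hKpos x' u' hup')
      (J0 x u hup).2.1 hmain
    linarith
  · intro x θ s s' hθ hs hss
    rcases hs.eq_or_lt with h0 | hsp
    · subst h0
      have := (hA x (s' • θ)).1
      rw [norm_smul, hθ, Real.norm_of_nonneg hss, mul_one] at this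
      rw [zero_smul, hg0]; linarith
    have hsp' : 0 < s' := by linarith
    have hn : ‖s • θ‖ = s := by rw [norm_smul, hθ, Real.norm_of_nonneg hs, mul_one]
    have hn' : ‖s' • θ‖ = s' := by rw [norm_smul, hθ, Real.norm_of_nonneg hsp'.le, mul_one]
    have hq : 0 < ‖s • θ‖ := by rwa [hn]
    have hq' : 0 < ‖s' • θ‖ := by rwa [hn']
    rw [hgK x _ hq, hgK x _ hq']
    have j0 := J0 x _ hq
    have j0' := J0 x _ hq'
    have j1' := J1 x _ hq'
    have j2' := J2 x _ hq'
    rw [hn'] at j0' j1' j2'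
    have hds : 0 ≤ s' - s := by linarith
    have hmain : p / 2 * (c2 / 2) * (s' - s) * s' ^ (-α - 1) ≤ K x (s • θ) - K x (s' • θ) := by
      simp only [hK]
      rw [← integral_sub j0.1 j0'.1]
      have hmono : ∫ z, (p / 2 * (s' - s) * s' * bb F x (s' • θ) z ^ (-(p + 2)) -
          p / 2 * (s' - s) * (c2 / (2 * C1)) * bb F x (s' • θ) z ^ (-(p + 1))) ∂ν ≤
          ∫ z, (bb F x (s • θ) z ^ (-p) - bb F x (s' • θ) z ^ (-p)) ∂ν := by
        refine integral_mono ((j2'.1.const_mul _).sub (j1'.1.const_mul _)) (j0.1.sub j0'.1)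
          (fun z => ?_)
        simp only
        have hB := hbp x (s • θ) z hq
        have hB' := hbp x (s' • θ) z hq'
        have hr := bb_ray hF x θ hθ hs hss z
        have hf : ‖z - x‖ ≤ bb F x (s' • θ) z := bb_fst x _ z
        have ht : 2 * τ * ‖z - x‖ ≤ c2 / (2 * C1) * bb F x (s' • θ) z := by
          have t1 : 2 * τ ≤ c2 / (2 * C1) := by
            rw [le_div_iff₀ (by positivity)]; linarith
          have := mul_le_mul_of_nonneg_right t1 (norm_nonneg (z - x))
          have t2 : 0 ≤ c2 / (2 * C1) := by positivity
          have := mul_le_mul_of_nonneg_left hf t2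
          linarith
        set B' := bb F x (s' • θ) z
        have hr2 : (s' - s) * (s' - c2 / (2 * C1) * B') ≤ B' ^ 2 - bb F x (s • θ) z ^ 2 := by
          refine le_trans ?_ hr
          gcongr
        have := ray_pt hB hB' hp0 hr2
        refine le_trans (le_of_eq ?_) this
        have e : B' ^ (-(p + 1)) = B' ^ (-(p + 2)) * B' := by
          rw [← Real.rpow_add_one hB'.ne']; congr 1; ring
        rw [e]; ring
      refine le_trans ?_ hmono
      rw [integral_sub (j2'.1.const_mul _) (j1'.1.const_mul _), integral_const_mul,
        integral_const_mul]
      have hc : 0 ≤ p / 2 * (s' - s) := by positivity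
      have a1 := mul_le_mul_of_nonneg_left j2'.2.1 (by positivity : 0 ≤ p / 2 * (s' - s) * s')
      have a2 := mul_le_mul_of_nonneg_left j1'.2.2
        (by positivity : 0 ≤ p / 2 * (s' - s) * (c2 / (2 * C1)))
      have e : s' ^ (-α - 1) = s' ^ (-α - 2) * s' := by
        rw [← Real.rpow_add_one hsp'.ne']; congr 1; ring
      have a3 : p / 2 * (s' - s) * (c2 / (2 * C1)) * (C1 * s' ^ (-α - 1)) =
          p / 2 * (s' - s) * (c2 / 2) * s' ^ (-α - 1) := by field_simp
      rw [a3] at a2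
      have a4 : p / 2 * (s' - s) * s' * (c2 * s' ^ (-α - 2)) =
          p / 2 * (s' - s) * c2 * s' ^ (-α - 1) := by rw [e]; ring
      rw [a4] at a1
      linarith
    have := SM s s' (K x (s • θ)) (K x (s' • θ)) hsp hss (hKpos x _ hq') j0'.2.2 hmain
    refine le_trans ?_ this
    gcongr
    exact min_le_left _ _

def pxx (d m : ℕ) (p : EuclideanSpace ℝ (Fin d ⊕ Fin m)) : EuclideanSpace ℝ (Fin d) :=
  WithLp.toLp 2 (fun i => p (Sum.inl i))

def ptt (d m : ℕ) (p : EuclideanSpace ℝ (Fin d ⊕ Fin m)) : EuclideanSpace ℝ (Fin m) :=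
  WithLp.toLp 2 (fun j => p (Sum.inr j))

theorem emb_inl (d m : ℕ) (x : EuclideanSpace ℝ (Fin d)) (t : EuclideanSpace ℝ (Fin m)) (i : Fin d) :
    emb d m x t (Sum.inl i) = x i := by simp [emb]

theorem emb_inr (d m : ℕ) (x : EuclideanSpace ℝ (Fin d)) (t : EuclideanSpace ℝ (Fin m)) (i : Fin m) :
    emb d m x t (Sum.inr i) = t i := by simp [emb]

theorem emb_pp (d m : ℕ) (p : EuclideanSpace ℝ (Fin d ⊕ Fin m)) :
    emb d m (pxx d m p) (ptt d m p) = p := by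
  ext k
  rcases k with i | j
  · rw [emb_inl]; rfl
  · rw [emb_inr]; rfl

theorem pxx_emb (d m : ℕ) (x : EuclideanSpace ℝ (Fin d)) (t : EuclideanSpace ℝ (Fin m)) :
    pxx d m (emb d m x t) = x := by
  ext i; exact emb_inl d m x t i

theorem ptt_emb (d m : ℕ) (x : EuclideanSpace ℝ (Fin d)) (t : EuclideanSpace ℝ (Fin m)) :
    ptt d m (emb d m x t) = t := by
  ext i; exact emb_inr d m x t i

theorem tn_eq (d m : ℕ) (p : EuclideanSpace ℝ (Fin d ⊕ Fin m)) : tn d m p = ‖ptt d m p‖ := by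
  rw [EuclideanSpace.norm_eq]
  simp [tn, ptt]

theorem dist_emb (d m : ℕ) (x x' : EuclideanSpace ℝ (Fin d)) (t t' : EuclideanSpace ℝ (Fin m)) :
    dist (emb d m x t) (emb d m x' t') = √(‖x - x'‖ ^ 2 + ‖t - t'‖ ^ 2) := by
  rw [EuclideanSpace.dist_eq, EuclideanSpace.real_norm_sq_eq, EuclideanSpace.real_norm_sq_eq]
  simp [Fintype.sum_sum_type, emb_inl, emb_inr, Real.dist_eq, sq_abs]

theorem dist_emb_le (d m : ℕ) (x x' : EuclideanSpace ℝ (Fin d)) (t t' : EuclideanSpace ℝ (Fin m)) :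
    dist (emb d m x t) (emb d m x' t') ≤ ‖x - x'‖ + ‖t - t'‖ := by
  rw [dist_emb]
  apply Real.sqrt_le_iff.2 ⟨by positivity, ?_⟩
  nlinarith [mul_nonneg (norm_nonneg (x - x')) (norm_nonneg (t - t'))]

theorem le_dist_emb1 (d m : ℕ) (x x' : EuclideanSpace ℝ (Fin d)) (t t' : EuclideanSpace ℝ (Fin m)) :
    ‖x - x'‖ ≤ dist (emb d m x t) (emb d m x' t') := by
  rw [dist_emb]
  apply Real.le_sqrt_of_sq_le
  nlinarith [sq_nonneg ‖t - t'‖]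

theorem le_dist_emb2 (d m : ℕ) (x x' : EuclideanSpace ℝ (Fin d)) (t t' : EuclideanSpace ℝ (Fin m)) :
    ‖t - t'‖ ≤ dist (emb d m x t) (emb d m x' t') := by
  rw [dist_emb]
  apply Real.le_sqrt_of_sq_le
  nlinarith [sq_nonneg ‖x - x'‖]

theorem haar_E (d : ℕ) :
    (μH[(d : ℝ)] : Measure (EuclideanSpace ℝ (Fin d))).IsAddHaarMeasure := by
  simpa using MeasureTheory.isAddHaarMeasure_hausdorffMeasure (E := EuclideanSpace ℝ (Fin d))

theorem graph_measure (d m : ℕ) (τ : ℝ) (hτ : τ ≤ 1)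
    (F : EuclideanSpace ℝ (Fin d) → EuclideanSpace ℝ (Fin m))
    (hF : ∀ x z, ‖F x - F z‖ ≤ τ * ‖x - z‖) :
    ∃ ν : Measure (EuclideanSpace ℝ (Fin d)), μH[(d : ℝ)] ≤ ν ∧
      ν ≤ ((2 : NNReal) ^ d) • (μH[(d : ℝ)] : Measure (EuclideanSpace ℝ (Fin d))) ∧
      ∀ f : EuclideanSpace ℝ (Fin d ⊕ Fin m) → ℝ,
        ∫ y in graphG d m F, f y ∂μH[(d : ℝ)] = ∫ z, f (emb d m z (F z)) ∂ν := by
  set γ : EuclideanSpace ℝ (Fin d) → EuclideanSpace ℝ (Fin d ⊕ Fin m) :=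
    fun x => emb d m x (F x) with hγ
  have hl : LipschitzWith 2 γ := by
    apply LipschitzWith.of_dist_le_mul
    intro x y
    refine (dist_emb_le d m _ _ _ _).trans ?_
    have := hF x y
    rw [dist_eq_norm]
    push_cast
    nlinarith [norm_nonneg (x - y)]
  have ha : AntilipschitzWith 1 γ := by
    apply AntilipschitzWith.of_le_mul_dist
    intro x y
    rw [dist_eq_norm]
    simpa using le_dist_emb1 d m x y (F x) (F y)
  have hce : Topology.IsClosedEmbedding γ := ha.isClosedEmbedding hl.uniformContinuous
  have hme : MeasurableEmbedding γ := hce.measurableEmbedding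
  have hr : graphG d m F = range γ := by
    ext p; simp only [graphG, mem_setOf_eq, mem_range, hγ]
    exact exists_congr fun x => eq_comm
  refine ⟨Measure.comap γ μH[(d : ℝ)], ?_, ?_, ?_⟩
  · refine Measure.le_iff.2 fun s hs => ?_
    rw [hme.comap_apply]
    simpa using ha.le_hausdorffMeasure_image (d := (d : ℝ)) (by positivity) s
  · refine Measure.le_iff.2 fun s hs => ?_
    rw [hme.comap_apply]
    refine (hl.hausdorffMeasure_image_le (d := (d : ℝ)) (by positivity) s).trans (le_of_eq ?_)
    simp [ENNReal.smul_def]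
  · intro f
    rw [hr, ← hme.map_comap, hme.integral_map]

/-- Bilipschitz change of variables adapted to a small Lipschitz graph: for
integers `n - 1 > d ≥ 1` and `α > 0` there are `τ₀ > 0` and, for each `0 < τ ≤ τ₀`, a constant
`C ≥ 1` (depending only on `n, d, α, τ`) such that for every Lipschitz
`F : ℝ^d → ℝ^{n-d}` with constant at most `τ`, there is a bilipschitz homeomorphism
`ρ : ℝⁿ → ℝⁿ` with constant at most `C`, with `ρ(ℝ^d) = Γ` (the graph of `F`), and such that
`|D(ρ(x,t))/|t| - 1|² dxdt/|t|^{n-d}` is a Carleson measure relative to `ℝ^d`: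
`∫_{B((x,0),r) \ ℝ^d} |D(ρ(y,t))/|t| - 1|² dydt/|t|^{n-d} ≤ C r^d` for all `x ∈ ℝ^d`,
`r > 0`. -/
theorem statement19 (d m : ℕ) (hd : 1 ≤ d) (hm : 2 ≤ m) (α : ℝ) (hα : 0 < α) :
    ∃ τ₀ : ℝ, 0 < τ₀ ∧ ∀ τ : ℝ, 0 < τ → τ ≤ τ₀ →
      ∃ C : ℝ, 1 ≤ C ∧
        ∀ F : EuclideanSpace ℝ (Fin d) → EuclideanSpace ℝ (Fin m),
          LipschitzWith τ.toNNReal F →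
          ∃ ρ : EuclideanSpace ℝ (Fin d ⊕ Fin m) → EuclideanSpace ℝ (Fin d ⊕ Fin m),
            Function.Bijective ρ ∧
            (∀ p q, C⁻¹ * dist p q ≤ dist (ρ p) (ρ q) ∧ dist (ρ p) (ρ q) ≤ C * dist p q) ∧
            ρ '' {p | ∀ j, p (Sum.inr j) = 0} = graphG d m F ∧
            ∀ (x : EuclideanSpace ℝ (Fin d)) (r : ℝ), 0 < r →
              (∫⁻ p in ball (emb d m x 0) r ∩ {p | tn d m p ≠ 0},
                ENNReal.ofReal
                  ((Dfun d m α (graphG d m F) (ρ p) / tn d m p - 1) ^ 2 /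
                    tn d m p ^ m)) ≤ ENNReal.ofReal (C * r ^ d) := by
  haveI := haar_E d
  obtain ⟨τ₀, c, L, hτ₀, hτ₀1, hc, hL, H⟩ := main_g (V := EuclideanSpace ℝ (Fin m))
    (μH[(d : ℝ)] : Measure (EuclideanSpace ℝ (Fin d))) ((2 : NNReal) ^ d) hα
  refine ⟨τ₀, hτ₀, fun τ hτ hτ0 => ?_⟩
  set C1 : ℝ := 3 / c + L / c + 2 * L / c ^ 2 with hC1
  have hC1p : 0 < C1 := by positivity
  refine ⟨2 + 2 * C1 + 9 * L, by linarith, fun F hFl => ?_⟩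
  have hτ1 : τ ≤ 1 := hτ0.trans hτ₀1
  have hF : ∀ x z, ‖F x - F z‖ ≤ τ * ‖x - z‖ := by
    intro x z
    have := hFl.dist_le_mul x z
    rwa [dist_eq_norm, dist_eq_norm, Real.coe_toNNReal _ hτ.le] at this
  obtain ⟨ν, hν1, hν2, hν3⟩ := graph_measure d m τ hτ1 F hF
  classical
  obtain ⟨h1, h2, h3⟩ := H τ hτ0 F hF ν hν1 hν2 (fun x u => if u = 0 then 0 else
        (∫ z, bb F x u z ^ (-((Module.finrank ℝ (EuclideanSpace ℝ (Fin d)) : ℝ) + α)) ∂ν) ^ (-α⁻¹))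
        (fun x u => by split_ifs <;> rfl)
  set g : EuclideanSpace ℝ (Fin d) → EuclideanSpace ℝ (Fin m) → ℝ := (fun x u => if u = 0 then 0 else
        (∫ z, bb F x u z ^ (-((Module.finrank ℝ (EuclideanSpace ℝ (Fin d)) : ℝ) + α)) ∂ν) ^ (-α⁻¹))
    with hg
  have hgD : ∀ x u, u ≠ 0 → g x u = Dfun d m α (graphG d m F) (emb d m x (F x + u)) := by
    intro x u hu
    simp only [hg]
    rw [if_neg hu, Dfun, hν3]
    congr 2
    ext z
    rw [dist_emb, finrank_euclideanSpace_fin]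
    unfold bb
    congr 1
    ring
  obtain ⟨U, hUb, hU0, hUg, hUl, hUl'⟩ := absU_aux c L hc hL g h1 h2 h3
  refine ⟨fun p => emb d m (pxx d m p) (F (pxx d m p) + U (pxx d m p) (ptt d m p)), ?_, ?_, ?_, ?_⟩
  · constructor
    · intro p q h
      have e1 := congrArg (pxx d m) h
      have e2 := congrArg (ptt d m) h
      simp only [pxx_emb, ptt_emb] at e1 e2
      rw [e1] at e2
      have e3 := (hUb _).1 (add_left_cancel e2)
      rw [← emb_pp d m p, ← emb_pp d m q, e1, e3]
    · intro q
      obtain ⟨t, ht⟩ := (hUb (pxx d m q)).2 (ptt d m q - F (pxx d m q))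
      refine ⟨emb d m (pxx d m q) t, ?_⟩
      simp only [pxx_emb, ptt_emb]
      rw [ht, add_sub_cancel, emb_pp]
  · intro p q
    set x := pxx d m p with hx
    set x' := pxx d m q with hx'
    set t := ptt d m p with ht
    set t' := ptt d m q with ht'
    have hd0 : dist p q = dist (emb d m x t) (emb d m x' t') := by rw [emb_pp, emb_pp]
    have hx0 := norm_nonneg (x - x')
    have hF1 := hF x x'
    have hF2 : ‖F x - F x'‖ ≤ ‖x - x'‖ := by nlinarith
    have l1 := hUl x x' t t'
    have l2 := hUl' x x' t t'
    rw [← hC1] at l1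
    constructor
    · rw [inv_mul_le_iff₀ (by positivity), hd0]
      have a1 := le_dist_emb1 d m x x' (F x + U x t) (F x' + U x' t')
      have a2 := le_dist_emb2 d m x x' (F x + U x t) (F x' + U x' t')
      set R := dist (emb d m x (F x + U x t)) (emb d m x' (F x' + U x' t'))
      have a3 : ‖U x t - U x' t'‖ ≤ 2 * R := by
        have e : U x t - U x' t' = (F x + U x t - (F x' + U x' t')) - (F x - F x') := by abel
        rw [e]
        refine (norm_sub_le _ _).trans ?_
        linarith
      have hR : 0 ≤ R := dist_nonneg
      calc _ ≤ ‖x - x'‖ + ‖t - t'‖ := dist_emb_le d m _ _ _ _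
        _ ≤ R + 3 * L * (R + 2 * R) := by
          refine add_le_add a1 (l2.trans ?_)
          gcongr
        _ ≤ _ := by nlinarith [mul_nonneg hC1p.le hR]
    · rw [hd0]
      have a1 := le_dist_emb1 d m x x' t t'
      have a2 := le_dist_emb2 d m x x' t t'
      set R := dist (emb d m x t) (emb d m x' t')
      have hR : 0 ≤ R := dist_nonneg
      have e : F x + U x t - (F x' + U x' t') = (F x - F x') + (U x t - U x' t') := by abel
      refine (dist_emb_le d m _ _ _ _).trans ?_
      rw [e]
      calc _ ≤ R + (R + C1 * (R + R)) := by
            refine add_le_add a1 ((norm_add_le _ _).trans (add_le_add (hF2.trans a1) (l1.trans ?_)))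
            gcongr
        _ ≤ _ := by nlinarith [mul_nonneg hL.le hR]
  · ext q
    simp only [graphG, mem_image, mem_setOf_eq]
    constructor
    · rintro ⟨p, hp, rfl⟩
      refine ⟨pxx d m p, ?_⟩
      have : ptt d m p = 0 := by ext j; exact hp j
      rw [this, hU0, add_zero]
    · rintro ⟨x, rfl⟩
      refine ⟨emb d m x 0, fun j => by rw [emb_inr]; rfl, ?_⟩
      rw [pxx_emb, ptt_emb, hU0, add_zero]
  · intro x r hr
    have hz : ∀ p : EuclideanSpace ℝ (Fin d ⊕ Fin m), ENNReal.ofReal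
        ((Dfun d m α (graphG d m F) (emb d m (pxx d m p)
          (F (pxx d m p) + U (pxx d m p) (ptt d m p))) / tn d m p - 1) ^ 2 / tn d m p ^ m) = 0 := by
      intro p
      by_cases h0 : tn d m p = 0
      · rw [h0, zero_pow (by omega)]; simp
      · have ht : ptt d m p ≠ 0 := by
          intro h; apply h0; rw [tn_eq, h, norm_zero]
        have hne : U (pxx d m p) (ptt d m p) ≠ 0 := by
          intro h; exact ht ((hUb (pxx d m p)).1 (h.trans (hU0 _).symm))
        rw [← hgD _ _ hne, hUg, ← tn_eq, div_self h0]
        simp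
    simp only [hz]
    simp
end
end
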